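/- Let Ω ⊊ ℂ̂ be a simply connected domain whose complement contains at least two points, whose boundary ∂Ω is locally connected, and which satisfies ι(Ω) = Ω. Let F : Ω̄ → ℂ̂ be a continuous map such that F is meromorphic on Ω, F ∘ ι = ι ∘ F on Ω̄, and F(z) = ι(z) for every z ∈ ∂Ω. Then there exists a rational map R : ℂ̂ → ℂ̂ with ι ∘ R = R ∘ ι, such that R is injective on 𝔻, R(𝔻) = Ω, and F = R ∘ η ∘ (R|_𝔻)⁻¹ on Ω. -/

import Mathlib

open OnePoint Filter Topology Classical

/-- The involution `η(z) = 1/z` of the Riemann sphere `ℂ̂ = ℂ ∪ {∞}`. -/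
noncomputable def sphereInv : OnePoint ℂ → OnePoint ℂ
  | ∞ => ((0 : ℂ) : OnePoint ℂ)
  | (z : ℂ) => if z = 0 then ∞ else ((z⁻¹ : ℂ) : OnePoint ℂ)

/-- Complex conjugation `ι(z) = z̄` extended to the Riemann sphere by `ι(∞) = ∞`. -/
def sphereConj : OnePoint ℂ → OnePoint ℂ
  | ∞ => ∞
  | (z : ℂ) => (((starRingEnd ℂ) z : ℂ) : OnePoint ℂ)

/-- The anti-holomorphic involution `η⁻(z) = 1/z̄` of the Riemann sphere. -/
noncomputable def sphereInvConj : OnePoint ℂ → OnePoint ℂ := sphereInv ∘ sphereConj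

/-- The chart parametrization of the Riemann sphere at a point `p`: the identity chart
`w ↦ w` if `p` is finite, and the inverted chart `w ↦ 1/w` (sending `0 ↦ ∞`) if `p = ∞`. -/
noncomputable def sphereChart (p : OnePoint ℂ) : ℂ → OnePoint ℂ :=
  if p = (∞ : OnePoint ℂ) then (fun w => sphereInv ((w : ℂ) : OnePoint ℂ)) else (fun w => ((w : ℂ) : OnePoint ℂ))

/-- The coordinate of a point of the Riemann sphere in its chart: `z` for a finite point
`z`, and `0` for `∞`. -/
def sphereCoord : OnePoint ℂ → ℂ
  | ∞ => 0
  | (z : ℂ) => z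

/-- A self-map of the Riemann sphere is holomorphic at `p` if, read in the charts at `p`
and at `f p`, it is given near `p` by a function of one complex variable that is
analytic at the coordinate of `p`. -/
def SphereHolomorphicAt (f : OnePoint ℂ → OnePoint ℂ) (p : OnePoint ℂ) : Prop :=
  ∃ g : ℂ → ℂ, AnalyticAt ℂ g (sphereCoord p) ∧
    ∀ᶠ w in 𝓝 (sphereCoord p), f (sphereChart p w) = sphereChart (f p) (g w)

/-- A rational map: a nonconstant holomorphic self-map of the Riemann sphere. -/
def IsRationalMap (R : OnePoint ℂ → OnePoint ℂ) : Prop :=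
  (∀ p, SphereHolomorphicAt R p) ∧ ∀ c, R ≠ fun _ => c

/-- The open unit disk `𝔻`, regarded as a subset of the Riemann sphere. -/
def sphereUnitDisk : Set (OnePoint ℂ) := (fun z : ℂ => ((z : ℂ) : OnePoint ℂ)) '' Metric.ball 0 1

/-- **Hurwitz's theorem**: a locally uniform limit of zero-free holomorphic functions does not
vanish at a point around which it is not identically zero. -/
theorem TendstoLocallyUniformlyOn.ne_zero_of_forall_ne_zero {ι : Type*} {l : Filter ι} [l.NeBot]
    {U : Set ℂ} (hU : IsOpen U) {F : ι → ℂ → ℂ} {f : ℂ → ℂ}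
    (hF : TendstoLocallyUniformlyOn F f l U) (hd : ∀ n, DifferentiableOn ℂ (F n) U)
    (hne : ∀ n, ∀ z ∈ U, F n z ≠ 0) {b : ℂ} (hb : b ∈ U)
    (hf : ¬ ∀ᶠ z in 𝓝 b, f z = 0) : f b ≠ 0 := by
  intro hfb
  have hfd : DifferentiableOn ℂ f U := hF.differentiableOn (.of_forall hd) hU
  have hfan : AnalyticAt ℂ f b := hfd.analyticAt (hU.mem_nhds hb)
  have hev := hfan.eventually_eq_zero_or_eventually_ne_zero.resolve_left hf
  obtain ⟨r₁, hr₁, h₁⟩ := Metric.nhds_basis_closedBall.mem_iff.1 (hU.mem_nhds hb)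
  obtain ⟨r₂, hr₂, h₂⟩ := Metric.nhds_basis_closedBall.mem_iff.1 (eventually_nhdsWithin_iff.1 hev)
  set r := min r₁ r₂ with hr
  have hr0 : 0 < r := lt_min hr₁ hr₂
  have hrU : Metric.closedBall b r ⊆ U :=
    (Metric.closedBall_subset_closedBall (min_le_left _ _)).trans h₁
  have hfs : ∀ z ∈ Metric.sphere b r, f z ≠ 0 := fun z hz ↦
    h₂ (Metric.closedBall_subset_closedBall (min_le_right _ _) (Metric.sphere_subset_closedBall hz))
      (Metric.ne_of_mem_sphere hz hr0.ne')
  obtain ⟨x, hx, hxm⟩ := (isCompact_sphere b r).exists_isMinOn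
    (NormedSpace.sphere_nonempty.2 hr0.le)
    (hfd.continuousOn.norm.mono (Metric.sphere_subset_closedBall.trans hrU))
  set m := ‖f x‖
  have hm : 0 < m := norm_pos_iff.2 (hfs x hx)
  have hunif := (tendstoLocallyUniformlyOn_iff_forall_isCompact hU).1 hF _ hrU
    (isCompact_closedBall b r)
  obtain ⟨n, hn⟩ := ((Metric.tendstoUniformlyOn_iff.1 hunif) (m / 4) (by positivity)).exists
  have hcl : closure (Metric.ball b r) = Metric.closedBall b r := closure_ball b hr0.ne'
  have hdc : DiffContOnCl ℂ (fun z ↦ (F n z)⁻¹) (Metric.ball b r) := by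
    apply DifferentiableOn.diffContOnCl
    rw [hcl]
    exact ((hd n).mono hrU).inv fun z hz ↦ hne n z (hrU hz)
  have hmax := Complex.norm_le_of_forall_mem_frontier_norm_le Metric.isBounded_ball hdc
    (C := (3 * m / 4)⁻¹) (z := b) (fun z hz ↦ ?_) (subset_closure (Metric.mem_ball_self hr0))
  · have h3 := hn b (Metric.mem_closedBall_self hr0.le)
    rw [hfb, dist_zero_left] at h3
    rw [norm_inv, inv_le_inv₀ (norm_pos_iff.2 (hne n b hb)) (by positivity)] at hmax
    linarith
  · rw [frontier_ball b hr0.ne'] at hz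
    have h3 := hn z (Metric.sphere_subset_closedBall hz)
    have h4 : m ≤ ‖f z‖ := hxm hz
    have h5 : ‖f z‖ ≤ dist (f z) (F n z) + ‖F n z‖ := by
      rw [dist_eq_norm]; simpa using norm_add_le (f z - F n z) (F n z)
    rw [norm_inv]
    apply inv_anti₀ (by positivity)
    linarith

/-- **Montel's theorem** along an ultrafilter. -/
theorem exists_tendstoLocallyUniformlyOn_of_mapsTo_closedBall {ι : Type*} (l : Ultrafilter ι)
    {U : Set ℂ} (hU : IsOpen U) {F : ι → ℂ → ℂ} (hd : ∀ n, DifferentiableOn ℂ (F n) U)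
    (hF : ∀ n, Set.MapsTo (F n) U (Metric.closedBall 0 1)) :
    ∃ f : ℂ → ℂ, TendstoLocallyUniformlyOn F f l U := by
  have hlim : ∀ z ∈ U, ∃ y, Tendsto (fun n ↦ F n z) l (𝓝 y) := fun z hz ↦ by
    obtain ⟨y, -, hy⟩ := (isCompact_closedBall (0 : ℂ) 1).ultrafilter_le_nhds (l.map fun n ↦ F n z)
      (le_principal_iff.2 (Ultrafilter.mem_map.2 (Filter.mem_of_superset univ_mem
        fun n _ ↦ hF n hz)))
    exact ⟨y, hy⟩
  choose! f hf using hlim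
  refine ⟨f, Metric.tendstoLocallyUniformlyOn_iff.2 fun ε hε x hx ↦ ?_⟩
  obtain ⟨r, hr, hrU⟩ := Metric.isOpen_iff.1 hU x hx
  have hlip : ∀ n, ∀ y ∈ Metric.ball x r, dist (F n y) (F n x) ≤ 2 / r * dist y x := by
    intro n y hy
    refine Complex.dist_le_div_mul_dist_of_mapsTo_ball ((hd n).mono hrU) (fun z hz ↦ ?_) hy
    have h1 := hF n (hrU hz)
    have h2 := hF n hx
    rw [Metric.mem_closedBall] at *
    linarith [dist_triangle_right (F n z) (F n x) 0]
  set δ := min r (r * ε / 8) with hδ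
  have hδ0 : 0 < δ := by positivity
  have hsmall : ∀ n, ∀ y ∈ Metric.ball x δ, dist (F n y) (F n x) ≤ ε / 4 := by
    intro n y hy
    refine (hlip n y (Metric.ball_subset_ball (min_le_left _ _) hy)).trans ?_
    have : dist y x ≤ r * ε / 8 := (Metric.mem_ball.1 hy).le.trans (min_le_right _ _)
    calc 2 / r * dist y x ≤ 2 / r * (r * ε / 8) := by gcongr
      _ = ε / 4 := by field_simp; norm_num
  refine ⟨Metric.ball x δ, mem_nhdsWithin_of_mem_nhds (Metric.ball_mem_nhds x hδ0), ?_⟩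
  filter_upwards [(hf x hx).eventually (Metric.ball_mem_nhds (f x) (show 0 < ε / 4 by positivity))]
    with n hn y hy
  have hyU : y ∈ U := hrU (Metric.ball_subset_ball (min_le_left _ _) hy)
  have h1 : dist (f y) (f x) ≤ ε / 4 :=
    le_of_tendsto ((hf y hyU).dist (hf x hx)) (.of_forall fun n ↦ hsmall n y hy)
  have h2 := hsmall n y hy
  have h3 : dist (F n x) (f x) < ε / 4 := hn
  have h4 := dist_triangle4_right (f y) (F n y) (f x) (F n x)
  have h5 := dist_comm (f x) (F n x)
  linarith

/-- The Blaschke factor of the unit disk vanishing at `w`. -/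
noncomputable def blaschkeFactor (w z : ℂ) : ℂ := (z - w) / (1 - starRingEnd ℂ w * z)

theorem one_sub_conj_mul_ne_zero {w z : ℂ} (hw : ‖w‖ < 1) (hz : ‖z‖ < 1) :
    1 - starRingEnd ℂ w * z ≠ 0 := by
  intro h
  have h1 : ‖starRingEnd ℂ w * z‖ = 1 := by
    rw [← sub_eq_zero.1 h, norm_one]
  rw [norm_mul, RCLike.norm_conj] at h1
  nlinarith [norm_nonneg w, norm_nonneg z]

theorem norm_blaschkeFactor_lt_one {w z : ℂ} (hw : ‖w‖ < 1) (hz : ‖z‖ < 1) :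
    ‖blaschkeFactor w z‖ < 1 := by
  have h0 := one_sub_conj_mul_ne_zero hw hz
  rw [blaschkeFactor, norm_div, div_lt_one (norm_pos_iff.2 h0),
    ← sq_lt_sq₀ (norm_nonneg _) (norm_nonneg _), Complex.sq_norm, Complex.sq_norm]
  have h1 : ‖w‖ ^ 2 < 1 := by nlinarith [norm_nonneg w]
  have h2 : ‖z‖ ^ 2 < 1 := by nlinarith [norm_nonneg z]
  rw [Complex.sq_norm] at h1 h2
  have : Complex.normSq (1 - starRingEnd ℂ w * z) - Complex.normSq (z - w)
      = (1 - Complex.normSq w) * (1 - Complex.normSq z) := by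
    simp [Complex.normSq_apply]; ring
  nlinarith

theorem blaschkeFactor_injOn {w : ℂ} (hw : ‖w‖ < 1) :
    Set.InjOn (blaschkeFactor w) (Metric.ball 0 1) := by
  intro z hz z' hz' h
  rw [mem_ball_zero_iff] at hz hz'
  rw [blaschkeFactor, blaschkeFactor, div_eq_div_iff (one_sub_conj_mul_ne_zero hw hz)
    (one_sub_conj_mul_ne_zero hw hz')] at h
  have h1 : (1 - starRingEnd ℂ w * w) * (z - z') = 0 := by linear_combination h
  exact sub_eq_zero.1 ((mul_eq_zero.1 h1).resolve_left (one_sub_conj_mul_ne_zero hw hw))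

theorem hasDerivAt_blaschkeFactor {w z : ℂ} (hw : ‖w‖ < 1) (hz : ‖z‖ < 1) :
    HasDerivAt (blaschkeFactor w)
      ((1 - starRingEnd ℂ w * w) / (1 - starRingEnd ℂ w * z) ^ 2) z := by
  have h0 := one_sub_conj_mul_ne_zero hw hz
  refine (((hasDerivAt_id z).sub_const w).fun_div
    (((hasDerivAt_id z).const_mul (starRingEnd ℂ w)).const_sub 1) h0).congr_deriv ?_
  congr 1
  simp only [id]
  ring

/-- A univalent zero-free function on a simply connected domain has a holomorphic square root. -/
theorem exists_sq_eq_hasDerivAt {U : Set ℂ} (hUo : IsOpen U) (hUc : IsSimplyConnected U)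
    {k : ℂ → ℂ} (hki : Set.InjOn k U) (hkd : ∀ z ∈ U, DifferentiableAt ℂ k z)
    (hk0 : ∀ z ∈ U, k z ≠ 0) :
    ∃ h : ℂ → ℂ, (∀ z, h z ^ 2 = k z) ∧ (∀ z ∈ U, h z ≠ 0) ∧
      ∀ z ∈ U, HasDerivAt h (deriv k z / (2 * h z)) z := by
  obtain ⟨h, hhc, hhk⟩ := Complex.exists_continuousOn_pow_eq hUc hUo
    (fun z hz ↦ (hkd z hz).continuousAt.continuousWithinAt) (by rintro ⟨z, hz, h⟩; exact hk0 z hz h) two_ne_zero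
  have hh0 : ∀ z ∈ U, h z ≠ 0 := fun z hz h0 ↦ hk0 z hz (by rw [← hhk, h0]; simp)
  refine ⟨h, hhk, hh0, fun z hz ↦ ?_⟩
  have h2 : HasDerivAt (fun x : ℂ ↦ x ^ 2) (2 * h z) (h z) := by
    simpa using hasDerivAt_pow 2 (h z)
  have hcont : Tendsto h (𝓝[≠] z) (𝓝[≠] (h z)) := by
    rw [tendsto_nhdsWithin_iff]
    refine ⟨(hhc.continuousAt (hUo.mem_nhds hz)).tendsto.mono_left nhdsWithin_le_nhds, ?_⟩
    filter_upwards [self_mem_nhdsWithin, mem_nhdsWithin_of_mem_nhds (hUo.mem_nhds hz)]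
      with x hx hxU hxz
    exact hx (hki hxU hz (by rw [← hhk, ← hhk, Set.mem_singleton_iff.1 hxz]))
  have hs2 := (hasDerivAt_iff_tendsto_slope.1 h2).comp hcont
  have hsk := hasDerivAt_iff_tendsto_slope.1 (hkd z hz).hasDerivAt
  rw [hasDerivAt_iff_tendsto_slope]
  refine (hsk.div hs2 (mul_ne_zero two_ne_zero (hh0 z hz))).congr' ?_
  filter_upwards [self_mem_nhdsWithin, hcont self_mem_nhdsWithin,
    mem_nhdsWithin_of_mem_nhds (hUo.mem_nhds hz)] with x hx hhx hxU
  have hx' : x - z ≠ 0 := sub_ne_zero.2 hx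
  have hhx' : h x - h z ≠ 0 := sub_ne_zero.2 hhx
  have hxx : h x ^ 2 - h z ^ 2 ≠ 0 := by
    rw [hhk, hhk]
    exact sub_ne_zero.2 fun h0 ↦ hx (hki hxU hz h0)
  simp only [Pi.div_apply, Function.comp, slope_def_field, ← hhk]
  field_simp

/-- Univalent maps of `U` into the unit disk. -/
structure IsUnivalentToDisk (U : Set ℂ) (f : ℂ → ℂ) : Prop where
  mapsTo : Set.MapsTo f U (Metric.ball 0 1)
  injOn : Set.InjOn f U
  deriv_ne_zero : ∀ z ∈ U, deriv f z ≠ 0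

namespace IsUnivalentToDisk

variable {U : Set ℂ} {f : ℂ → ℂ}

theorem norm_lt_one (hf : IsUnivalentToDisk U f) {z : ℂ} (hz : z ∈ U) : ‖f z‖ < 1 := by
  simpa using hf.mapsTo hz

theorem hasDerivAt (hf : IsUnivalentToDisk U f) {z : ℂ} (hz : z ∈ U) :
    HasDerivAt f (deriv f z) z :=
  (differentiableAt_of_deriv_ne_zero (hf.deriv_ne_zero z hz)).hasDerivAt

theorem differentiableOn (hf : IsUnivalentToDisk U f) : DifferentiableOn ℂ f U := fun _ hz ↦
  (hf.hasDerivAt hz).differentiableAt.differentiableWithinAt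

theorem hasDerivAt_blaschkeFactor_comp (hf : IsUnivalentToDisk U f) {w z : ℂ} (hw : ‖w‖ < 1)
    (hz : z ∈ U) : HasDerivAt (fun z ↦ blaschkeFactor w (f z))
      ((1 - starRingEnd ℂ w * w) / (1 - starRingEnd ℂ w * f z) ^ 2 * deriv f z) z :=
  (hasDerivAt_blaschkeFactor hw (hf.norm_lt_one hz)).comp z (hf.hasDerivAt hz)

theorem blaschkeFactor_comp (hf : IsUnivalentToDisk U f) {w : ℂ} (hw : ‖w‖ < 1) :
    IsUnivalentToDisk U fun z ↦ blaschkeFactor w (f z) where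
  mapsTo z hz := by
    simpa using norm_blaschkeFactor_lt_one hw (hf.norm_lt_one hz)
  injOn := (blaschkeFactor_injOn hw).comp hf.injOn hf.mapsTo
  deriv_ne_zero z hz := by
    rw [(hf.hasDerivAt_blaschkeFactor_comp hw hz).deriv]
    exact mul_ne_zero (div_ne_zero (one_sub_conj_mul_ne_zero hw hw)
      (pow_ne_zero _ (one_sub_conj_mul_ne_zero hw (hf.norm_lt_one hz)))) (hf.deriv_ne_zero z hz)

/-- **Koebe's square root trick**. -/
theorem exists_norm_deriv_lt (hf : IsUnivalentToDisk U f) (hUo : IsOpen U)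
    (hUc : IsSimplyConnected U) {z₀ : ℂ} (hz₀ : z₀ ∈ U) (hfz₀ : f z₀ = 0) {w : ℂ}
    (hw : ‖w‖ < 1) (hwf : w ∉ f '' U) :
    ∃ g, IsUnivalentToDisk U g ∧ g z₀ = 0 ∧ ‖deriv f z₀‖ < ‖deriv g z₀‖ := by
  set k := fun z ↦ blaschkeFactor w (f z) with hk
  have hkU : IsUnivalentToDisk U k := hf.blaschkeFactor_comp hw
  have hk0 : ∀ z ∈ U, k z ≠ 0 := fun z hz ↦ div_ne_zero
    (sub_ne_zero.2 fun h ↦ hwf ⟨z, hz, h⟩) (one_sub_conj_mul_ne_zero hw (hf.norm_lt_one hz))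
  obtain ⟨h, hhk, hh0, hhd⟩ := exists_sq_eq_hasDerivAt hUo hUc hkU.injOn
    (fun z hz ↦ (hkU.hasDerivAt hz).differentiableAt) hk0
  have hhU : IsUnivalentToDisk U h :=
    { mapsTo := fun z hz ↦ by
        have h1 := hkU.norm_lt_one hz
        rw [← hhk, norm_pow] at h1
        rw [mem_ball_zero_iff]
        exact (sq_lt_one_iff₀ (norm_nonneg _)).1 h1
      injOn := fun z hz z' hz' hzz ↦ hkU.injOn hz hz' (by rw [← hhk, ← hhk, hzz])
      deriv_ne_zero := fun z hz ↦ by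
        rw [(hhd z hz).deriv]
        exact div_ne_zero (hkU.deriv_ne_zero z hz) (mul_ne_zero two_ne_zero (hh0 z hz)) }
  have ht1 := hhU.norm_lt_one hz₀
  have ht0 : 0 < ‖h z₀‖ := norm_pos_iff.2 (hh0 z₀ hz₀)
  refine ⟨fun z ↦ blaschkeFactor (h z₀) (h z), hhU.blaschkeFactor_comp ht1,
    by simp [blaschkeFactor], ?_⟩
  have hself : ∀ u : ℂ, ‖u‖ < 1 → ‖1 - starRingEnd ℂ u * u‖ = 1 - ‖u‖ ^ 2 := by
    intro u hu
    rw [Complex.conj_mul', ← Complex.ofReal_pow, ← Complex.ofReal_one, ← Complex.ofReal_sub,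
      Complex.norm_real, Real.norm_of_nonneg]
    nlinarith [norm_nonneg u]
  have hwt : ‖w‖ = ‖h z₀‖ ^ 2 := by
    rw [← norm_pow, hhk, hk]
    simp [blaschkeFactor, hfz₀]
  rw [(hhU.hasDerivAt_blaschkeFactor_comp ht1 hz₀).deriv, (hhd z₀ hz₀).deriv, hk,
    (hf.hasDerivAt_blaschkeFactor_comp hw hz₀).deriv, hfz₀]
  have hD : 0 < ‖deriv f z₀‖ := norm_pos_iff.2 (hf.deriv_ne_zero z₀ hz₀)
  simp only [norm_mul, norm_div, norm_pow, hself _ ht1, hself _ hw, mul_zero, sub_zero, norm_one,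
    Complex.norm_ofNat, hwt]
  set t := ‖h z₀‖
  have h1t : 0 < 1 - t ^ 2 := by nlinarith
  have : (1 - t ^ 2) / (1 - t ^ 2) ^ 2 * ((1 - (t ^ 2) ^ 2) / 1 ^ 2 * ‖deriv f z₀‖ / (2 * t))
      = ‖deriv f z₀‖ * ((1 + t ^ 2) / (2 * t)) := by
    field_simp; ring
  rw [this, lt_mul_iff_one_lt_right hD, one_lt_div (by positivity)]
  nlinarith [mul_pos (sub_pos.2 ht1) (sub_pos.2 ht1)]

end IsUnivalentToDisk

theorem exists_isUnivalentToDisk {U : Set ℂ} (hUo : IsOpen U) (hUc : IsSimplyConnected U)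
    (hU : U ≠ Set.univ) : ∃ f, IsUnivalentToDisk U f := by
  obtain ⟨a, ha⟩ := (Set.ne_univ_iff_exists_notMem U).1 hU
  have hd : ∀ z, HasDerivAt (fun z : ℂ ↦ z - a) 1 z := fun z ↦ (hasDerivAt_id z).sub_const a
  obtain ⟨h, hhk, hh0, hhd⟩ := exists_sq_eq_hasDerivAt hUo hUc
    (fun z _ z' _ hzz ↦ sub_left_injective hzz) (fun z _ ↦ (hd z).differentiableAt)
    (fun z hz h0 ↦ ha (by rwa [← sub_eq_zero.1 h0]))
  simp only [(hd _).deriv] at hhd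
  have hhinj : Function.Injective h := fun z z' hzz ↦ by
    have := hhk z
    rw [hzz, hhk z'] at this
    exact (sub_left_injective this).symm
  obtain ⟨x, hx⟩ := hUc.nonempty
  have hdiff : DifferentiableOn ℂ h U := fun z hz ↦
    (hhd z hz).differentiableAt.differentiableWithinAt
  have himg : h '' U ∈ 𝓝 (h x) := by
    have hstrict := (hdiff.analyticAt (hUo.mem_nhds hx)).hasStrictDerivAt
    rw [(hhd x hx).deriv] at hstrict
    rw [← hstrict.map_nhds_eq (div_ne_zero one_ne_zero (mul_ne_zero two_ne_zero (hh0 x hx)))]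
    exact Filter.image_mem_map (hUo.mem_nhds hx)
  obtain ⟨ε, hε, hεU⟩ := Metric.nhds_basis_closedBall.mem_iff.1 himg
  have hfar : ∀ z ∈ U, ε < ‖h z + h x‖ := by
    intro z hz
    by_contra! hle
    obtain ⟨y, hy, hyz⟩ := hεU (show -h z ∈ Metric.closedBall (h x) ε by
      rw [Metric.mem_closedBall, dist_eq_norm, ← norm_neg]
      rwa [show -(-h z - h x) = h z + h x by ring])
    have h1 := hhk y
    rw [hyz, neg_sq, hhk z] at h1
    rw [← sub_left_injective h1] at hyz
    exact hh0 z hz (by linear_combination hyz / 2)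
  have hne : ∀ z ∈ U, h z + h x ≠ 0 := fun z hz ↦ norm_pos_iff.1 (hε.trans (hfar z hz))
  refine ⟨fun z ↦ ε / (h z + h x), fun z hz ↦ ?_, fun z hz z' hz' hzz ↦ ?_, fun z hz ↦ ?_⟩
  · rw [mem_ball_zero_iff, norm_div, Complex.norm_real, Real.norm_of_nonneg hε.le,
      div_lt_one (hε.trans (hfar z hz))]
    exact hfar z hz
  · have hε' : (ε : ℂ) ≠ 0 := by exact_mod_cast hε.ne'
    have h1 := (div_eq_div_iff (hne z hz) (hne z' hz')).1 hzz
    exact hhinj (add_right_cancel (mul_left_cancel₀ hε' h1)).symm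
  · have h1 := (hasDerivAt_const z (ε : ℂ)).fun_div ((hhd z hz).add_const (h x)) (hne z hz)
    rw [h1.deriv]
    have hε' : (ε : ℂ) ≠ 0 := by exact_mod_cast hε.ne'
    have := hh0 z hz
    have := hne z hz
    simp [*]

/-- The **Riemann mapping theorem**. -/
theorem exists_bijOn_unitBall {U : Set ℂ} (hUo : IsOpen U) (hUc : IsSimplyConnected U)
    (hU : U ≠ Set.univ) {z₀ : ℂ} (hz₀ : z₀ ∈ U) :
    ∃ f : ℂ → ℂ, IsUnivalentToDisk U f ∧ f '' U = Metric.ball 0 1 ∧ f z₀ = 0 := by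
  set S : Set ℝ := {d | ∃ f, IsUnivalentToDisk U f ∧ f z₀ = 0 ∧ d = ‖deriv f z₀‖} with hS
  obtain ⟨f₀, hf₀⟩ := exists_isUnivalentToDisk hUo hUc hU
  have hne : S.Nonempty := ⟨_, _, hf₀.blaschkeFactor_comp (hf₀.norm_lt_one hz₀),
    by simp [blaschkeFactor], rfl⟩
  obtain ⟨r, hr, hrU⟩ := Metric.isOpen_iff.1 hUo z₀ hz₀
  have hbdd : BddAbove S := by
    refine ⟨1 / r, ?_⟩
    rintro _ ⟨f, hf, hf0, rfl⟩
    refine Complex.norm_deriv_le_div_of_mapsTo_ball (hf.differentiableOn.mono hrU)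
      (fun z hz ↦ ?_) hr
    rw [hf0]
    exact Metric.ball_subset_closedBall (hf.mapsTo (hrU hz))
  obtain ⟨u, -, hu, huS⟩ := exists_seq_tendsto_sSup hne hbdd
  choose F hF hF0 hFu using huS
  obtain ⟨f, hf⟩ := exists_tendstoLocallyUniformlyOn_of_mapsTo_closedBall (hyperfilter ℕ) hUo
    (fun n ↦ (hF n).differentiableOn)
    (fun n z hz ↦ Metric.ball_subset_closedBall ((hF n).mapsTo hz))
  have hfd : DifferentiableOn ℂ f U :=
    hf.differentiableOn (.of_forall fun n ↦ (hF n).differentiableOn) hUo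
  have hfan : AnalyticOnNhd ℂ f U := hfd.analyticOnNhd hUo
  have hderiv := hf.deriv (.of_forall fun n ↦ (hF n).differentiableOn) hUo
  have hM : ‖deriv f z₀‖ = sSup S := by
    refine tendsto_nhds_unique (hderiv.tendsto_at hz₀).norm ?_
    simpa only [Function.comp_def, ← hFu] using hu.mono_left Nat.hyperfilter_le_atTop
  have hMpos : deriv f z₀ ≠ 0 := by
    obtain ⟨d, g, hg, hg0, rfl⟩ := id hne
    rw [← norm_pos_iff, hM]
    exact (norm_pos_iff.2 (hg.deriv_ne_zero z₀ hz₀)).trans_le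
      (le_csSup hbdd ⟨g, hg, hg0, rfl⟩)
  have hpre : IsPreconnected U := hUc.isPathConnected.isConnected.isPreconnected
  have hnc : ∀ c : ℂ, ∀ b ∈ U, ¬ ∀ᶠ z in 𝓝 b, f z - c = 0 := by
    intro c b hb hev
    have h1 : Set.EqOn f (fun _ ↦ c) U := hfan.eqOn_of_preconnected_of_eventuallyEq
      analyticOnNhd_const hpre hb (hev.mono fun z hz ↦ sub_eq_zero.1 hz)
    refine hMpos ?_
    rw [(h1.eventuallyEq_of_mem (hUo.mem_nhds hz₀)).deriv_eq, deriv_const]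
  have hf0 : f z₀ = 0 := by
    refine tendsto_nhds_unique (hf.tendsto_at hz₀) ?_
    simp [hF0]
  have hle : ∀ z ∈ U, ‖f z‖ ≤ 1 := fun z hz ↦
    le_of_tendsto (hf.tendsto_at hz).norm (.of_forall fun n ↦ ((hF n).norm_lt_one hz).le)
  have hfU : IsUnivalentToDisk U f :=
    { mapsTo := fun z hz ↦ by
        rw [mem_ball_zero_iff]
        refine (hle z hz).lt_of_ne fun h1 ↦ ?_
        have hmax : IsMaxOn (norm ∘ f) U z := fun x hx ↦ by
          simpa [h1] using hle x hx
        have h2 := Complex.eqOn_of_isPreconnected_of_isMaxOn_norm hpre hUo hfd hz hmax hz₀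
        rw [Function.const_apply, hf0] at h2
        rw [← h2, norm_zero] at h1
        exact zero_ne_one h1
      injOn := fun z hz z' hz' hzz ↦ by
        by_contra hne'
        have hV : IsOpen (U \ {z}) := hUo.sdiff isClosed_singleton
        have hz'V : z' ∈ U \ {z} := ⟨hz', fun h ↦ hne' h.symm⟩
        have hcv : TendstoLocallyUniformlyOn (fun n x ↦ F n x - F n z) (fun x ↦ f x - f z)
            (hyperfilter ℕ) (U \ {z}) := by
          rw [Metric.tendstoLocallyUniformlyOn_iff] at hf ⊢
          intro ε hε x hx
          obtain ⟨t, ht, h⟩ := hf (ε / 2) (by positivity) x hx.1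
          refine ⟨t, nhdsWithin_mono _ Set.sdiff_subset ht, ?_⟩
          filter_upwards [h, (Metric.tendsto_nhds.1 ((Metric.tendstoLocallyUniformlyOn_iff.2
            hf).tendsto_at hz)) (ε / 2) (by positivity)] with n hn hn' y hy
          have h3 := hn y hy
          have h4 := dist_sub_sub_le (f y) (f z) (F n y) (F n z)
          rw [dist_comm (f z)] at h4
          linarith
        exact hcv.ne_zero_of_forall_ne_zero hV
          (fun n ↦ ((hF n).differentiableOn.mono Set.sdiff_subset).sub_const _)
          (fun n x hx ↦ sub_ne_zero.2 fun h ↦ hx.2 ((hF n).injOn hx.1 hz h)) hz'V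
          (hnc _ z' hz') (by rw [hzz, sub_self])
      deriv_ne_zero := fun z hz ↦ by
        refine hderiv.ne_zero_of_forall_ne_zero hUo
          (fun n ↦ (hF n).differentiableOn.deriv hUo) (fun n ↦ (hF n).deriv_ne_zero) hz
          fun hev ↦ hMpos ?_
        exact hfan.deriv.eqOn_of_preconnected_of_eventuallyEq analyticOnNhd_const hpre hz hev hz₀ }
  refine ⟨f, hfU, Set.Subset.antisymm hfU.mapsTo.image_subset fun w hw ↦ ?_, hf0⟩
  by_contra hwf
  obtain ⟨g, hg, hg0, hlt⟩ := hfU.exists_norm_deriv_lt hUo hUc hz₀ hf0 (by simpa using hw) hwf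
  exact absurd (le_csSup hbdd ⟨g, hg, hg0, rfl⟩) (by rw [← hM]; exact not_le.2 hlt)



/-- The filter of points of the unit disk approaching the unit circle. -/
noncomputable def innerCircleFilter : Filter ℂ := comap (fun z : ℂ => ‖z‖) (𝓝[<] (1 : ℝ))

theorem eventually_norm_innerCircleFilter {a : ℝ} (ha : a < 1) :
    ∀ᶠ z in innerCircleFilter, a < ‖z‖ ∧ ‖z‖ < 1 :=
  (eventually_comap.2 <| by
    filter_upwards [Ioo_mem_nhdsLT ha] with t ht z hz
    rw [hz]; exact ht)

theorem circleIntegral_inv_radius (t : ℝ) (ht : 0 < t) (G : ℂ → ℂ) :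
    (∮ z in C(0, t⁻¹), G z) =
      ∮ z in C(0, t), ((starRingEnd ℂ z)⁻¹ / z) * G (starRingEnd ℂ z)⁻¹ := by
  have key : ∀ θ : ℝ, (starRingEnd ℂ (circleMap 0 t θ))⁻¹ = circleMap 0 t⁻¹ θ := by
    intro θ
    simp only [circleMap, zero_add, map_mul, Complex.conj_ofReal, mul_inv, Complex.ofReal_inv]
    congr 1
    rw [← Complex.exp_conj, ← Complex.exp_neg]
    simp
  unfold circleIntegral
  congr 1
  funext θ
  simp only [deriv_circleMap, key, smul_eq_mul]
  have : circleMap 0 t θ ≠ 0 := circleMap_ne_center ht.ne'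
  field_simp

theorem norm_conj_inv (z : ℂ) : ‖(starRingEnd ℂ z)⁻¹‖ = ‖z‖⁻¹ := by simp

theorem eventually_norm_sub_inv_le {w : ℂ} (hw : ‖w‖ ≠ 1) :
    ∃ M, ∀ᶠ z in innerCircleFilter,
      ‖(z - w)⁻¹‖ ≤ M ∧ ‖((starRingEnd ℂ z)⁻¹ - w)⁻¹‖ ≤ M := by
  have hd : 0 < |1 - ‖w‖| := abs_pos.2 (sub_ne_zero.2 hw.symm)
  refine ⟨(|1 - ‖w‖| / 2)⁻¹, ?_⟩
  have h1 : ∀ᶠ t : ℝ in 𝓝[<] 1, |1 - ‖w‖| / 2 < |t - ‖w‖| := by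
    refine Tendsto.eventually_const_lt (half_lt_self hd) ?_
    refine (Continuous.tendsto' ?_ _ _ rfl).mono_left nhdsWithin_le_nhds
    fun_prop
  have h2 : ∀ᶠ t : ℝ in 𝓝[<] 1, |1 - ‖w‖| / 2 < |t⁻¹ - ‖w‖| := by
    refine Tendsto.eventually_const_lt (half_lt_self hd) ?_
    have : ContinuousAt (fun t : ℝ => |t⁻¹ - ‖w‖|) 1 := by
      refine ContinuousAt.abs (ContinuousAt.sub (continuousAt_inv₀ one_ne_zero) continuousAt_const)
    have h3 := this.tendsto.mono_left (nhdsWithin_le_nhds (s := Set.Iio 1))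
    simpa using h3
  refine eventually_comap.2 ?_
  filter_upwards [h1, h2] with t h1 h2 z hz
  have e1 := abs_norm_sub_norm_le z w
  have e2 := abs_norm_sub_norm_le (starRingEnd ℂ z)⁻¹ w
  rw [norm_conj_inv, hz] at e2
  rw [hz] at e1
  rw [norm_inv, norm_inv]
  constructor <;> gcongr
  · exact h1.le.trans e1
  · exact h2.le.trans e2

theorem tendsto_conj_inv_sub_self :
    Tendsto (fun z : ℂ => (starRingEnd ℂ z)⁻¹ - z) innerCircleFilter (𝓝 0) := by
  have h0 : Tendsto (fun t : ℝ => |t⁻¹ - t|) (𝓝[<] 1) (𝓝 0) := by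
    have : ContinuousAt (fun t : ℝ => |t⁻¹ - t|) 1 :=
      ContinuousAt.abs (ContinuousAt.sub (continuousAt_inv₀ one_ne_zero) continuousAt_id)
    have h3 := this.tendsto.mono_left (nhdsWithin_le_nhds (s := Set.Iio 1))
    simpa using h3
  rw [tendsto_zero_iff_norm_tendsto_zero]
  refine (h0.comp tendsto_comap).congr' ?_
  filter_upwards [eventually_norm_innerCircleFilter zero_lt_one] with z hz
  have hz0 : z ≠ 0 := norm_pos_iff.1 hz.1
  have : (starRingEnd ℂ z)⁻¹ - z = (((‖z‖ ^ 2)⁻¹ - 1 : ℝ) : ℂ) * z := by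
    have h : z * starRingEnd ℂ z = ((‖z‖ ^ 2 : ℝ) : ℂ) := by
      rw [Complex.mul_conj, Complex.normSq_eq_norm_sq]
    have hc : starRingEnd ℂ z ≠ 0 := by simpa using hz0
    rw [Complex.ofReal_sub, Complex.ofReal_inv, ← h]
    field_simp
    simp
  rw [this, norm_mul, Complex.norm_real, Real.norm_eq_abs, Function.comp]
  have hpos := hz.1
  rw [← abs_of_pos hpos, ← abs_mul, abs_of_pos hpos]
  congr 1
  field_simp

theorem tendsto_circleIntegral_sub {f g : ℂ → ℂ} {ρ : ℝ} (hρ : 1 < ρ)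
    (hf : DifferentiableOn ℂ f (Metric.ball 0 1))
    (hg : ∀ z : ℂ, 1 < ‖z‖ → ‖z‖ < ρ → DifferentiableAt ℂ g z)
    (hfg : Tendsto (fun z => g (starRingEnd ℂ z)⁻¹ - f z) innerCircleFilter (𝓝 0))
    (hb : ∃ M, ∀ᶠ z in innerCircleFilter, ‖f z‖ ≤ M) {w : ℂ} (hw : ‖w‖ ≠ 1) :
    Tendsto (fun t : ℝ => (∮ z in C(0, t), (z - w)⁻¹ • f z) -
      ∮ z in C(0, t⁻¹), (z - w)⁻¹ • g z) (𝓝[<] 1) (𝓝 0) := by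
  obtain ⟨M, hM⟩ := eventually_norm_sub_inv_le hw
  obtain ⟨B, hB⟩ := hb
  let H : ℂ → ℂ := fun z => (z - w)⁻¹ * f z -
    ((starRingEnd ℂ z)⁻¹ / z) * (((starRingEnd ℂ z)⁻¹ - w)⁻¹ * g (starRingEnd ℂ z)⁻¹)
  have hbd1 : (fun z : ℂ => z⁻¹) =O[innerCircleFilter] (fun _ => (1 : ℝ)) := by
    refine Asymptotics.IsBigO.of_bound 2 ?_
    filter_upwards [eventually_norm_innerCircleFilter (a := 1 / 2) (by norm_num)] with z hz
    rw [norm_inv, inv_le_comm₀ (by linarith) (by norm_num)]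
    norm_num
    linarith
  have hbds : (fun z : ℂ => (starRingEnd ℂ z)⁻¹) =O[innerCircleFilter] (fun _ => (1 : ℝ)) :=
    by
    rw [← Asymptotics.isBigO_norm_left] at hbd1 ⊢
    simpa using hbd1
  have hbdf : f =O[innerCircleFilter] (fun _ => (1 : ℝ)) :=
    Asymptotics.IsBigO.of_bound B (hB.mono fun _ h => by simpa using h)
  have hbdM1 : (fun z : ℂ => (z - w)⁻¹) =O[innerCircleFilter] (fun _ => (1 : ℝ)) :=
    Asymptotics.IsBigO.of_bound M (hM.mono fun _ h => by simpa using h.1)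
  have hbdM2 : (fun z : ℂ => ((starRingEnd ℂ z)⁻¹ - w)⁻¹) =O[innerCircleFilter]
      (fun _ => (1 : ℝ)) :=
    Asymptotics.IsBigO.of_bound M (hM.mono fun _ h => by simpa using h.2)
  have hs : (fun z : ℂ => (starRingEnd ℂ z)⁻¹ - z) =o[innerCircleFilter] (fun _ => (1 : ℝ)) :=
    (Asymptotics.isLittleO_one_iff ℝ).2 tendsto_conj_inv_sub_self
  have hfg' : (fun z : ℂ => g (starRingEnd ℂ z)⁻¹ - f z) =o[innerCircleFilter]
      (fun _ => (1 : ℝ)) := (Asymptotics.isLittleO_one_iff ℝ).2 hfg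
  have hw0 : (fun _ : ℂ => w) =O[innerCircleFilter] (fun _ => (1 : ℝ)) :=
    Asymptotics.isBigO_const_const _ one_ne_zero _
  have hne : ∀ᶠ z in innerCircleFilter, z ≠ 0 ∧ z - w ≠ 0 ∧ (starRingEnd ℂ z)⁻¹ - w ≠ 0 := by
    have h2 : ∀ᶠ t : ℝ in 𝓝[<] 1, t ≠ ‖w‖ ∧ t⁻¹ ≠ ‖w‖ := by
      refine nhdsWithin_le_nhds (Filter.Eventually.and ?_ ?_)
      · exact (continuousAt_id (x := (1 : ℝ))).eventually_ne hw.symm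
      · exact (continuousAt_inv₀ (one_ne_zero (α := ℝ))).eventually_ne (by simpa using hw.symm)
    have h3 := (tendsto_comap (f := fun z : ℂ => ‖z‖)).eventually h2
    change ∀ᶠ z in innerCircleFilter, _ at h3
    filter_upwards [eventually_norm_innerCircleFilter zero_lt_one, h3] with z hz h3
    refine ⟨norm_pos_iff.1 hz.1, ?_, ?_⟩
    · rintro h
      exact h3.1 (by rw [sub_eq_zero.1 h])
    · rintro h
      exact h3.2 (by rw [← norm_conj_inv, sub_eq_zero.1 h])
  have hH : Tendsto H innerCircleFilter (𝓝 0) := by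
    rw [← Asymptotics.isLittleO_one_iff ℝ]
    have t1 : (fun z => w * z⁻¹ * (z - w)⁻¹ * ((starRingEnd ℂ z)⁻¹ - w)⁻¹ * f z *
        ((starRingEnd ℂ z)⁻¹ - z)) =o[innerCircleFilter] (fun _ => (1 : ℝ)) := by
      simpa using ((((hw0.mul hbd1).mul hbdM1).mul hbdM2).mul hbdf).mul_isLittleO hs
    have t2 : (fun z => z⁻¹ * (starRingEnd ℂ z)⁻¹ * ((starRingEnd ℂ z)⁻¹ - w)⁻¹ *
        (g (starRingEnd ℂ z)⁻¹ - f z)) =o[innerCircleFilter] (fun _ => (1 : ℝ)) := by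
      simpa using ((hbd1.mul hbds).mul hbdM2).mul_isLittleO hfg'
    refine (t1.sub t2).congr' ?_ EventuallyEq.rfl
    filter_upwards [hne] with z hz
    obtain ⟨h0, h1, h2⟩ := hz
    simp only [H]
    generalize (starRingEnd ℂ z)⁻¹ = u at *
    field_simp
    ring
  rw [Metric.tendsto_nhds]
  intro ε hε
  have hε' : 0 < ε / (4 * Real.pi) := by positivity
  have hHε : ∀ᶠ z in innerCircleFilter, ‖H z‖ ≤ ε / (4 * Real.pi) := by
    filter_upwards [Metric.tendsto_nhds.1 hH _ hε'] with z hz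
    rw [dist_zero_right] at hz
    exact hz.le
  have hall := eventually_comap.1 (hHε.and hne)
  have hlow : ρ⁻¹ < 1 := inv_lt_one_of_one_lt₀ hρ
  filter_upwards [hall, Ioo_mem_nhdsLT hlow] with t ht htr
  have ht0 : 0 < t := lt_trans (inv_pos.2 (by linarith)) htr.1
  rw [circleIntegral_inv_radius t ht0]
  have hsph : ∀ z ∈ Metric.sphere (0 : ℂ) t, ‖z‖ = t := fun z hz => by simpa using hz
  have hcf : ContinuousOn f (Metric.sphere 0 t) := hf.continuousOn.mono fun z hz => by
    rw [Metric.mem_ball, dist_zero_right, hsph z hz]; exact htr.2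
  have hcs : ContinuousOn (fun z : ℂ => (starRingEnd ℂ z)⁻¹) (Metric.sphere 0 t) := by
    refine Complex.continuous_conj.continuousOn.inv₀ fun z hz => ?_
    simpa using (ht z (hsph z hz)).2.1
  have hcg : ContinuousOn (fun z => g (starRingEnd ℂ z)⁻¹) (Metric.sphere 0 t) := by
    intro z hz
    refine ContinuousAt.comp_continuousWithinAt (f := fun z : ℂ => (starRingEnd ℂ z)⁻¹)
      (hg _ ?_ ?_).continuousAt (hcs z hz)
    · rw [norm_conj_inv, hsph z hz]; exact (one_lt_inv₀ ht0).2 htr.2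
    · rw [norm_conj_inv, hsph z hz]; exact inv_lt_of_inv_lt₀ (by linarith) htr.1
  have i1 : CircleIntegrable (fun z => (z - w)⁻¹ • f z) 0 t := by
    refine ContinuousOn.circleIntegrable ht0.le (ContinuousOn.smul (ContinuousOn.inv₀
      (by fun_prop) fun z hz => (ht z (hsph z hz)).2.2.1) hcf)
  have i2 : CircleIntegrable (fun z => ((starRingEnd ℂ z)⁻¹ / z) *
      (((starRingEnd ℂ z)⁻¹ - w)⁻¹ • g (starRingEnd ℂ z)⁻¹)) 0 t := by
    refine ContinuousOn.circleIntegrable ht0.le (ContinuousOn.mul (hcs.div continuousOn_id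
      fun z hz => (ht z (hsph z hz)).2.1) (ContinuousOn.smul (ContinuousOn.inv₀
      (hcs.sub continuousOn_const) fun z hz => (ht z (hsph z hz)).2.2.2) hcg))
  rw [← circleIntegral.integral_sub i1 i2, dist_zero_right]
  calc _ ≤ 2 * Real.pi * t * (ε / (4 * Real.pi)) :=
        circleIntegral.norm_integral_le_of_norm_le_const ht0.le fun z hz =>
          (ht z (hsph z hz)).1
    _ = t * (ε / 2) := by field_simp; ring
    _ < ε := by nlinarith [htr.2]

/-- Two functions, holomorphic inside the unit disk and in an outer annulus respectively, which
match asymptotically across the unit circle, glue to a single holomorphic function. -/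
theorem exists_analytic_extension_across_unit_circle {f g : ℂ → ℂ} {ρ : ℝ} (hρ : 1 < ρ)
    (hf : DifferentiableOn ℂ f (Metric.ball 0 1))
    (hg : ∀ z : ℂ, 1 < ‖z‖ → ‖z‖ < ρ → DifferentiableAt ℂ g z)
    (hfg : Tendsto (fun z => g (starRingEnd ℂ z)⁻¹ - f z) innerCircleFilter (𝓝 0))
    (hb : ∃ M, ∀ᶠ z in innerCircleFilter, ‖f z‖ ≤ M) :
    ∃ (h : ℂ → ℂ) (s : ℝ), 1 < s ∧ s < ρ ∧ (∀ z : ℂ, ‖z‖ < s → AnalyticAt ℂ h z) ∧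
      (∀ z : ℂ, ‖z‖ < 1 → h z = f z) ∧ ∀ z : ℂ, 1 < ‖z‖ → ‖z‖ < s → h z = g z := by
  obtain ⟨s, hs1, hsρ⟩ := exists_between hρ
  have hs0 : 0 < s := by linarith
  have hgs : ContinuousOn g (Metric.sphere 0 s) := fun z hz => by
    have : ‖z‖ = s := by simpa using hz
    exact (hg z (by linarith) (by linarith)).continuousAt.continuousWithinAt
  let h : ℂ → ℂ := fun w => (2 * Real.pi * Complex.I : ℂ)⁻¹ • ∮ z in C(0, s), (z - w)⁻¹ • g z
  have hpi : (2 * Real.pi * Complex.I : ℂ) ≠ 0 := Complex.two_pi_I_ne_zero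
  refine ⟨h, s, hs1, hsρ, ?_, ?_, ?_⟩
  · lift s to NNReal using hs0.le
    have := hasFPowerSeriesOn_cauchy_integral (f := g) (c := 0) (R := s)
      (ContinuousOn.circleIntegrable s.2 hgs) (by exact_mod_cast hs0)
    intro z hz
    refine this.analyticAt_of_mem ?_
    simpa [← NNReal.coe_lt_coe] using hz
  · intro w hw
    have T := tendsto_circleIntegral_sub hρ hf hg hfg hb hw.ne
    have E : ∀ᶠ t : ℝ in 𝓝[<] 1, (∮ z in C(0, t), (z - w)⁻¹ • f z) -
      (∮ z in C(0, t⁻¹), (z - w)⁻¹ • g z) = (2 * Real.pi * Complex.I : ℂ) • (f w - h w) := by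
      have hlow : max ‖w‖ s⁻¹ < 1 := max_lt hw (inv_lt_one_of_one_lt₀ hs1)
      filter_upwards [Ioo_mem_nhdsLT hlow] with t ht
      have hwt := (le_max_left _ _).trans_lt ht.1
      have hst := (le_max_right _ _).trans_lt ht.1
      have ht0 : 0 < t := lt_of_le_of_lt (norm_nonneg _) hwt
      have ht1 : 1 < t⁻¹ := (one_lt_inv₀ ht0).2 ht.2
      have hts : t⁻¹ < s := inv_lt_of_inv_lt₀ (by linarith) hst
      have e1 : (∮ z in C(0, t), (z - w)⁻¹ • f z) = (2 * Real.pi * Complex.I : ℂ) • f w := by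
        refine DifferentiableOn.circleIntegral_sub_inv_smul (hf.mono fun z hz => ?_) (by simpa)
        simp only [Metric.mem_closedBall, Metric.mem_ball, dist_zero_right] at *
        linarith [ht.2]
      have hd : ∀ z : ℂ, t⁻¹ ≤ ‖z‖ → ‖z‖ ≤ s →
          DifferentiableAt ℂ (fun z => (z - w)⁻¹ • g z) z := by
        intro z h1 h2
        refine DifferentiableAt.smul (DifferentiableAt.fun_inv (differentiableAt_id.sub_const w) ?_)
          (hg z (by linarith) (by linarith))
        intro h
        rw [show z = w from sub_eq_zero.1 h] at h1
        linarith
      have e2 : (∮ z in C(0, s), (z - w)⁻¹ • g z) = ∮ z in C(0, t⁻¹), (z - w)⁻¹ • g z := by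
        refine Complex.circleIntegral_eq_of_differentiable_on_annulus_off_countable
          (by linarith) hts.le Set.countable_empty ?_ ?_
        · intro z hz
          simp only [Set.mem_sdiff, Metric.mem_closedBall, Metric.mem_ball, dist_zero_right,
            not_lt] at hz
          exact (hd z hz.2 hz.1).continuousAt.continuousWithinAt
        · intro z hz
          simp only [Set.mem_sdiff, Metric.mem_closedBall, Metric.mem_ball, dist_zero_right,
            not_le] at hz
          exact hd z hz.1.2.le hz.1.1.le
      rw [e1, ← e2, smul_sub]
      simp only [h]
      rw [smul_inv_smul₀ hpi]
    have := tendsto_nhds_unique (tendsto_const_nhds.congr' (E.mono fun _ h => h.symm)) T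
    rw [smul_eq_zero_iff_right hpi, sub_eq_zero] at this
    exact this.symm
  · intro w hw hws
    have T := tendsto_circleIntegral_sub hρ hf hg hfg hb hw.ne'
    have E : ∀ᶠ t : ℝ in 𝓝[<] 1, (∮ z in C(0, t), (z - w)⁻¹ • f z) -
      (∮ z in C(0, t⁻¹), (z - w)⁻¹ • g z) = (2 * Real.pi * Complex.I : ℂ) • (g w - h w) := by
      have hlow : ‖w‖⁻¹ < 1 := inv_lt_one_of_one_lt₀ hw
      filter_upwards [Ioo_mem_nhdsLT hlow] with t ht
      have hwpos : 0 < ‖w‖ := by linarith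
      have ht0 : 0 < t := lt_trans (inv_pos.2 hwpos) ht.1
      have ht1 : 1 < t⁻¹ := (one_lt_inv₀ ht0).2 ht.2
      have htw : t⁻¹ < ‖w‖ := inv_lt_of_inv_lt₀ hwpos ht.1
      have zero : ∀ (k : ℂ → ℂ) (r : ℝ), 0 ≤ r → r < ‖w‖ →
          (DifferentiableOn ℂ k (Metric.closedBall 0 r)) →
          (∮ z in C(0, r), (z - w)⁻¹ • k z) = 0 := by
        intro k r hr hrw hk
        refine DiffContOnCl.circleIntegral_eq_zero hr ?_
        refine DifferentiableOn.diffContOnCl (DifferentiableOn.smul (DifferentiableOn.fun_inv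
          (differentiableOn_id.sub_const w) fun z hz => ?_) hk |>.mono Metric.closure_ball_subset_closedBall)
        rw [Metric.mem_closedBall, dist_zero_right] at hz
        intro h
        rw [show z = w from sub_eq_zero.1 h] at hz
        linarith
      have e1 : (∮ z in C(0, t), (z - w)⁻¹ • f z) = 0 :=
        zero f t ht0.le (by linarith [ht.2]) (hf.mono fun z hz => by
          simp only [Metric.mem_closedBall, Metric.mem_ball, dist_zero_right] at *
          linarith [ht.2])
      have hgw : DifferentiableAt ℂ g w := hg w hw (by linarith)
      have hopen : IsOpen {z : ℂ | 1 < ‖z‖ ∧ ‖z‖ < ρ} :=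
        (isOpen_lt continuous_const continuous_norm).inter
          (isOpen_lt continuous_norm continuous_const)
      have hdg : DifferentiableOn ℂ (dslope g w) {z : ℂ | 1 < ‖z‖ ∧ ‖z‖ < ρ} := by
        rw [Complex.differentiableOn_dslope (hopen.mem_nhds ⟨hw, by linarith⟩)]
        exact fun z hz => (hg z hz.1 hz.2).differentiableWithinAt
      have hd : ∀ z : ℂ, t⁻¹ ≤ ‖z‖ → ‖z‖ ≤ s → DifferentiableAt ℂ (dslope g w) z :=
        fun z h1 h2 => hdg.differentiableAt (hopen.mem_nhds ⟨by linarith, by linarith⟩)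
      have e2 : (∮ z in C(0, s), dslope g w z) = ∮ z in C(0, t⁻¹), dslope g w z := by
        refine Complex.circleIntegral_eq_of_differentiable_on_annulus_off_countable
          (by linarith) (by linarith) Set.countable_empty ?_ ?_
        · intro z hz
          simp only [Set.mem_sdiff, Metric.mem_closedBall, Metric.mem_ball, dist_zero_right,
            not_lt] at hz
          exact (hd z hz.2 hz.1).continuousAt.continuousWithinAt
        · intro z hz
          simp only [Set.mem_sdiff, Metric.mem_closedBall, Metric.mem_ball, dist_zero_right,
            not_le] at hz
          exact hd z hz.1.2.le hz.1.1.le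
      have split : ∀ r : ℝ, 1 < r → r < ρ → r ≠ ‖w‖ → (∮ z in C(0, r), dslope g w z) =
          (∮ z in C(0, r), (z - w)⁻¹ • g z) - ∮ z in C(0, r), (z - w)⁻¹ • g w := by
        intro r h1 h2 h3
        have hsph : ∀ z ∈ Metric.sphere (0 : ℂ) r, ‖z‖ = r := fun z hz => by simpa using hz
        have hne : ∀ z ∈ Metric.sphere (0 : ℂ) r, z - w ≠ 0 := fun z hz h =>
          h3 (by rw [← hsph z hz, sub_eq_zero.1 h])
        have hinv : ContinuousOn (fun z => (z - w)⁻¹) (Metric.sphere (0 : ℂ) r) :=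
          ContinuousOn.inv₀ (by fun_prop) hne
        rw [← circleIntegral.integral_sub]
        · refine circleIntegral.integral_congr (by linarith) fun z hz => ?_
          rw [dslope_of_ne _ (sub_ne_zero.1 (hne z hz)), slope_def_module, smul_sub]
        · refine ContinuousOn.circleIntegrable (by linarith) (hinv.smul fun z hz => ?_)
          exact (hg z (by rw [hsph z hz]; exact h1)
            (by rw [hsph z hz]; exact h2)).continuousAt.continuousWithinAt
        · exact ContinuousOn.circleIntegrable (by linarith) (hinv.smul continuousOn_const)
      rw [split s hs1 hsρ hws.ne', split t⁻¹ ht1 (by linarith) htw.ne,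
        zero (fun _ => g w) t⁻¹ (by linarith) htw (differentiableOn_const _), sub_zero,
        circleIntegral.integral_smul_const,
        circleIntegral.integral_sub_inv_of_mem_ball (by simpa using hws)] at e2
      rw [e1, ← e2, smul_sub]
      simp only [h]
      rw [smul_inv_smul₀ hpi]
      ring
    have := tendsto_nhds_unique (tendsto_const_nhds.congr' (E.mono fun _ h => h.symm)) T
    rw [smul_eq_zero_iff_right hpi, sub_eq_zero] at this
    exact this.symm

theorem eqOn_id_of_mapsTo_ball_of_hasDerivAt_one {g : ℂ → ℂ}
    (hd : DifferentiableOn ℂ g (Metric.ball 0 1))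
    (hm : Set.MapsTo g (Metric.ball 0 1) (Metric.ball 0 1)) (h0 : g 0 = 0)
    (h1 : HasDerivAt g 1 0) {z : ℂ} (hz : ‖z‖ < 1) : g z = z := by
  have := Complex.affine_of_mapsTo_ball_of_norm_dslope_eq_div (c := 0) (R₁ := 1) (R₂ := 1)
    (z₀ := 0) hd (by rw [h0]; exact fun x hx => Metric.ball_subset_closedBall (hm hx))
    (by simp) (by simp [dslope_same, h1.deriv])
  have := this (show z ∈ Metric.ball 0 1 by simpa using hz)
  simpa [dslope_same, h1.deriv, h0] using this

/-- The inverse of a Riemann map, together with its properness. -/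
theorem IsUnivalentToDisk.exists_inverse {U : Set ℂ} {f : ℂ → ℂ} (hf : IsUnivalentToDisk U f)
    (hUo : IsOpen U) (himg : f '' U = Metric.ball 0 1) :
    ∃ ψ : ℂ → ℂ, Set.MapsTo ψ (Metric.ball 0 1) U ∧ (∀ w : ℂ, ‖w‖ < 1 → f (ψ w) = w) ∧
      (∀ u ∈ U, ψ (f u) = u) ∧
      (∀ w : ℂ, ‖w‖ < 1 → HasDerivAt ψ (deriv f (ψ w))⁻¹ w) ∧
      ∀ C ⊆ U, IsCompact C → ∀ᶠ w in innerCircleFilter, ψ w ∉ C := by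
  have hbij : Set.BijOn f U (Metric.ball 0 1) := ⟨hf.mapsTo, hf.injOn, himg.ge⟩
  have hball : ∀ {w : ℂ}, ‖w‖ < 1 → w ∈ Metric.ball (0 : ℂ) 1 := fun h => by simpa using h
  have hinv := hbij.invOn_invFunOn
  have hψU : Set.MapsTo (Function.invFunOn f U) (Metric.ball 0 1) U := hbij.surjOn.mapsTo_invFunOn
  refine ⟨Function.invFunOn f U, hψU, fun w hw => hinv.2 (hball hw), fun u hu => hinv.1 hu,
    fun w hw => ?_, fun C hCU hC => ?_⟩
  · have hu := hψU (hball hw)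
    have hstrict : HasStrictDerivAt f (deriv f (Function.invFunOn f U w))
        (Function.invFunOn f U w) :=
      (hf.differentiableOn.analyticAt (hUo.mem_nhds hu)).hasStrictDerivAt
    have := hstrict.to_local_left_inverse (hf.deriv_ne_zero _ hu) (g := Function.invFunOn f U)
      (Filter.mem_of_superset (hUo.mem_nhds hu) fun u hu => hinv.1 hu)
    rw [hinv.2 (hball hw)] at this
    exact this.hasDerivAt
  · have hfC : IsCompact (f '' C) := hC.image_of_continuousOn (hf.differentiableOn.continuousOn.mono hCU)
    obtain ⟨r, hr1, hr⟩ : ∃ r < 1, ∀ u ∈ C, ‖f u‖ ≤ r := by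
      rcases C.eq_empty_or_nonempty with rfl | hne
      · exact ⟨0, by norm_num, by simp⟩
      · obtain ⟨u₀, hu₀, hmax⟩ := hC.exists_isMaxOn hne
          ((hf.differentiableOn.continuousOn.mono hCU).norm)
        exact ⟨_, hf.norm_lt_one (hCU hu₀), fun u hu => hmax hu⟩
    filter_upwards [eventually_norm_innerCircleFilter hr1] with w hw hwC
    have := hr _ hwC
    rw [hinv.2 (hball hw.2)] at this
    linarith [hw.1]

/-- The Riemann map of a conjugation-symmetric domain of the sphere containing `∞`, read in the
coordinate `u = 1 / (z - a)` at infinity. -/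
theorem exists_symmetric_uniformization {K U : Set ℂ} (hK : K.Nontrivial)
    (hconj : ∀ k ∈ K, starRingEnd ℂ k ∈ K) {a : ℂ} (ha : a ∈ K)
    (hU : ∀ u, u ∈ U ↔ ∀ k ∈ K, 1 + u * (a - k) ≠ 0) (hUo : IsOpen U)
    (hUc : IsSimplyConnected U) :
    ∃ ψ : ℂ → ℂ, DifferentiableOn ℂ ψ (Metric.ball 0 1) ∧ Set.BijOn ψ (Metric.ball 0 1) U ∧
      ψ 0 = 0 ∧ deriv ψ 0 ≠ 0 ∧
      (∀ w : ℂ, ‖w‖ < 1 → ψ w * (1 + (starRingEnd ℂ a - a) * starRingEnd ℂ (ψ (starRingEnd ℂ w)))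
        = starRingEnd ℂ (ψ (starRingEnd ℂ w))) ∧
      ∀ C ⊆ U, IsCompact C → ∀ᶠ w in innerCircleFilter, ψ w ∉ C := by
  have h0U : (0 : ℂ) ∈ U := by simp [hU]
  have hUne : U ≠ Set.univ := by
    obtain ⟨b, hb, hab⟩ := hK.exists_ne a
    intro h
    have hba : b - a ≠ 0 := sub_ne_zero.2 hab
    have := (hU (b - a)⁻¹).1 (h ▸ Set.mem_univ _) b hb
    apply this
    field_simp
    ring
  obtain ⟨f₀, hf₀, himg₀, hf₀0⟩ := exists_bijOn_unitBall hUo hUc hUne h0U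
  have hd0 := hf₀.deriv_ne_zero 0 h0U
  set c : ℂ := starRingEnd ℂ (deriv f₀ 0) / ‖deriv f₀ 0‖ with hc
  have hn0 : ((‖deriv f₀ 0‖ : ℝ) : ℂ) ≠ 0 := by simpa using hd0
  have hcn : ‖c‖ = 1 := by
    rw [hc, norm_div, Complex.norm_conj, Complex.norm_real, norm_norm, div_self (by simpa using hd0)]
  have hc0 : c ≠ 0 := norm_ne_zero_iff.1 (by rw [hcn]; exact one_ne_zero)
  have hcd : c * deriv f₀ 0 = (‖deriv f₀ 0‖ : ℝ) := by
    rw [hc, div_mul_eq_mul_div, Complex.conj_mul', sq, mul_div_assoc, div_self hn0, mul_one]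
  set f : ℂ → ℂ := fun u => c * f₀ u with hfdef
  have hfd : ∀ u ∈ U, HasDerivAt f (c * deriv f₀ u) u := fun u hu =>
    (hf₀.hasDerivAt hu).const_mul c
  have hf : IsUnivalentToDisk U f :=
    { mapsTo := fun u hu => by simpa [hfdef, hcn] using hf₀.mapsTo hu
      injOn := fun u hu v hv h => hf₀.injOn hu hv (mul_left_cancel₀ hc0 h)
      deriv_ne_zero := fun u hu => by
        rw [(hfd u hu).deriv]
        exact mul_ne_zero hc0 (hf₀.deriv_ne_zero u hu) }
  have himg : f '' U = Metric.ball 0 1 := by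
    refine Set.Subset.antisymm (Set.image_subset_iff.2 hf.mapsTo) fun w hw => ?_
    have : c⁻¹ * w ∈ f₀ '' U := by rw [himg₀]; simpa [hcn] using hw
    obtain ⟨u, hu, h⟩ := this
    exact ⟨u, hu, by simp [hfdef, h, hc0]⟩
  have hf0 : f 0 = 0 := by simp [hfdef, hf₀0]
  have hfd0 : deriv f 0 = (‖deriv f₀ 0‖ : ℝ) := by rw [(hfd 0 h0U).deriv, hcd]
  obtain ⟨ψ, hψU, hfψ, hψf, hψd, hproper⟩ := hf.exists_inverse hUo himg
  have hball : ∀ {w : ℂ}, ‖w‖ < 1 → w ∈ Metric.ball (0 : ℂ) 1 := fun h => by simpa using h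
  have hψ0 : ψ 0 = 0 := by simpa [hf0] using hψf 0 h0U
  have hψd0 : HasDerivAt ψ (‖deriv f₀ 0‖⁻¹ : ℝ) 0 := by
    have := hψd 0 (by simp)
    rw [hψ0, hfd0] at this
    simpa using this
  refine ⟨ψ, fun w hw => (hψd w (by simpa using hw)).differentiableAt.differentiableWithinAt,
    ⟨hψU, fun w hw v hv h => ?_, fun u hu => ⟨f u, hf.mapsTo hu, hψf u hu⟩⟩, hψ0, ?_, ?_, hproper⟩
  · rw [← hfψ w (by simpa using hw), h, hfψ v (by simpa using hv)]
  · rw [hψd0.deriv]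
    simpa using hd0
  · set σ : ℂ → ℂ := fun w => starRingEnd ℂ (ψ (starRingEnd ℂ w)) with hσ
    have hσd : ∀ w : ℂ, ‖w‖ < 1 →
        HasDerivAt σ (starRingEnd ℂ (deriv f (ψ (starRingEnd ℂ w)))⁻¹) w := by
      intro w hw
      have := (hψd (starRingEnd ℂ w) (by simpa using hw)).conj_conj
      rw [Complex.conj_conj] at this
      exact this
    have hσd0 : HasDerivAt σ (‖deriv f₀ 0‖⁻¹ : ℝ) 0 := by
      have := hψd0.conj_conj
      simpa [Function.comp_def] using this
    have hψc : ∀ w : ℂ, ‖w‖ < 1 → ψ (starRingEnd ℂ w) ∈ U := fun w hw => hψU (by simpa using hw)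
    have hfac : ∀ w k : ℂ, 1 + (starRingEnd ℂ a - k) * σ w =
        starRingEnd ℂ (1 + ψ (starRingEnd ℂ w) * (a - starRingEnd ℂ k)) := by
      intro w k
      simp [hσ]
      ring
    have hden : ∀ w : ℂ, ‖w‖ < 1 → 1 + (starRingEnd ℂ a - a) * σ w ≠ 0 := by
      intro w hw
      rw [hfac, Ne, map_eq_zero]
      exact (hU _).1 (hψc w hw) _ (hconj a ha)
    set τ : ℂ → ℂ := fun w => σ w / (1 + (starRingEnd ℂ a - a) * σ w) with hτ
    have hτU : ∀ w : ℂ, ‖w‖ < 1 → τ w ∈ U := by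
      intro w hw
      refine (hU _).2 fun k hk => ?_
      have h1 : 1 + τ w * (a - k) = (1 + (starRingEnd ℂ a - k) * σ w) /
          (1 + (starRingEnd ℂ a - a) * σ w) := by
        have h2 : τ w * (1 + (starRingEnd ℂ a - a) * σ w) = σ w :=
          div_mul_cancel₀ _ (hden w hw)
        rw [eq_div_iff (hden w hw)]
        linear_combination (a - k) * h2
      rw [h1]
      refine div_ne_zero ?_ (hden w hw)
      rw [hfac, Ne, map_eq_zero]
      exact (hU _).1 (hψc w hw) _ (hconj k hk)
    have hτd : ∀ w : ℂ, ‖w‖ < 1 → ∀ d, HasDerivAt σ d w → HasDerivAt τ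
        (d / (1 + (starRingEnd ℂ a - a) * σ w) ^ 2) w := by
      intro w hw d hd
      refine (hd.fun_div ((hd.const_mul (starRingEnd ℂ a - a)).const_add 1) (hden w hw)).congr_deriv
        ?_
      ring
    have hσ0 : σ 0 = 0 := by simp [hσ, hψ0]
    have hτ0 : τ 0 = 0 := by simp [hτ, hσ0]
    have hτd0 : HasDerivAt τ (‖deriv f₀ 0‖⁻¹ : ℝ) 0 := by
      simpa [hσ0] using hτd 0 (by simp) _ hσd0
    have hcomp : ∀ w : ℂ, ‖w‖ < 1 → f (τ w) = w := by
      intro w hw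
      refine eqOn_id_of_mapsTo_ball_of_hasDerivAt_one (g := fun w => f (τ w)) (fun v hv => ?_)
        (fun v hv => hf.mapsTo (hτU v (by simpa using hv))) (by simp [hτ0, hf0]) ?_ hw
      · have hv' : ‖v‖ < 1 := by simpa using hv
        exact ((hf.hasDerivAt (hτU v hv')).comp v (hτd v hv' _ (hσd v hv'))).differentiableAt
          |>.differentiableWithinAt
      · have h1 : HasDerivAt f (deriv f 0) (τ 0) := by rw [hτ0]; exact hf.hasDerivAt h0U
        refine (h1.comp 0 hτd0).congr_deriv ?_
        rw [hfd0, Complex.ofReal_inv]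
        exact mul_inv_cancel₀ hn0
    intro w hw
    have : τ w = ψ w := by rw [← hψf _ (hτU w hw), hcomp w hw]
    rw [← this]
    exact div_mul_cancel₀ _ (hden w hw)

theorem sphereInv_infty : sphereInv ∞ = ((0 : ℂ) : OnePoint ℂ) := rfl

theorem sphereInv_zero : sphereInv ((0 : ℂ) : OnePoint ℂ) = ∞ := if_pos rfl

theorem sphereInv_coe {z : ℂ} (hz : z ≠ 0) :
    sphereInv (z : OnePoint ℂ) = ((z⁻¹ : ℂ) : OnePoint ℂ) := if_neg hz

theorem sphereConj_infty : sphereConj ∞ = ∞ := rfl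

theorem sphereConj_coe (z : ℂ) :
    sphereConj (z : OnePoint ℂ) = ((starRingEnd ℂ z : ℂ) : OnePoint ℂ) := rfl

theorem sphereCoord_infty : sphereCoord ∞ = 0 := rfl

theorem sphereCoord_coe (z : ℂ) : sphereCoord (z : OnePoint ℂ) = z := rfl

theorem sphereChart_infty : sphereChart ∞ = fun w : ℂ => sphereInv (w : OnePoint ℂ) := if_pos rfl

theorem sphereChart_coe (z : ℂ) : sphereChart (z : OnePoint ℂ) = fun w : ℂ => (w : OnePoint ℂ) :=
  if_neg (OnePoint.coe_ne_infty z)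

theorem sphereInv_sphereInv (p : OnePoint ℂ) : sphereInv (sphereInv p) = p := by
  induction p using OnePoint.rec with
  | infty => rw [sphereInv_infty, sphereInv_zero]
  | coe z =>
    rcases eq_or_ne z 0 with rfl | hz
    · rw [sphereInv_zero, sphereInv_infty]
    · rw [sphereInv_coe hz, sphereInv_coe (inv_ne_zero hz), inv_inv]

theorem sphereConj_sphereConj (p : OnePoint ℂ) : sphereConj (sphereConj p) = p := by
  induction p using OnePoint.rec with
  | infty => rfl
  | coe z => rw [sphereConj_coe, sphereConj_coe, Complex.conj_conj]

theorem sphereInv_sphereConj (p : OnePoint ℂ) :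
    sphereInv (sphereConj p) = sphereConj (sphereInv p) := by
  induction p using OnePoint.rec with
  | infty => rw [sphereConj_infty, sphereInv_infty, sphereConj_coe, map_zero]
  | coe z =>
    rcases eq_or_ne z 0 with rfl | hz
    · rw [sphereConj_coe, map_zero, sphereInv_zero, sphereConj_infty]
    · rw [sphereConj_coe, sphereInv_coe hz, sphereConj_coe, sphereInv_coe (by simpa using hz),
        map_inv₀]

theorem continuous_sphereInv : Continuous sphereInv := by
  rw [continuous_iff_continuousAt]
  intro p
  induction p using OnePoint.rec with
  | infty =>
    rw [OnePoint.continuousAt_infty', sphereInv_infty, Filter.coclosedCompact_eq_cocompact,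
      ← Metric.cobounded_eq_cocompact]
    refine ((OnePoint.continuous_coe.tendsto 0).comp tendsto_inv₀_cobounded).congr' ?_
    filter_upwards [Bornology.eventually_ne_cobounded (0 : ℂ)] with z hz
    exact (sphereInv_coe hz).symm
  | coe z =>
    rw [OnePoint.continuousAt_coe]
    rcases eq_or_ne z 0 with rfl | hz
    · rw [continuousAt_iff_punctured_nhds]
      have h0 : (sphereInv ∘ ((↑) : ℂ → OnePoint ℂ)) 0 = ∞ := sphereInv_zero
      rw [h0]
      have h1 : Tendsto ((↑) : ℂ → OnePoint ℂ) (Bornology.cobounded ℂ) (𝓝 ∞) := by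
        rw [Metric.cobounded_eq_cocompact, ← Filter.coclosedCompact_eq_cocompact]
        exact OnePoint.tendsto_coe_infty
      refine (h1.comp tendsto_inv₀_nhdsNE_zero).congr' ?_
      filter_upwards [self_mem_nhdsWithin] with z hz
      exact (sphereInv_coe hz).symm
    · have : ContinuousAt (fun w : ℂ => ((w⁻¹ : ℂ) : OnePoint ℂ)) z :=
        OnePoint.continuous_coe.continuousAt.comp (continuousAt_inv₀ hz)
      refine this.congr ?_
      filter_upwards [eventually_ne_nhds hz] with w hw
      exact (sphereInv_coe hw).symm

/-- `sphereInv` as a homeomorphism. -/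
noncomputable def sphereInvHomeomorph : OnePoint ℂ ≃ₜ OnePoint ℂ where
  toFun := sphereInv
  invFun := sphereInv
  left_inv := sphereInv_sphereInv
  right_inv := sphereInv_sphereInv
  continuous_toFun := continuous_sphereInv
  continuous_invFun := continuous_sphereInv

/-- The translation `z ↦ z + c` of the Riemann sphere. -/
noncomputable def sphereTranslate (c : ℂ) : OnePoint ℂ ≃ₜ OnePoint ℂ :=
  (Homeomorph.addRight c).onePointCongr

theorem sphereTranslate_infty (c : ℂ) : sphereTranslate c ∞ = ∞ := rfl

theorem sphereTranslate_coe (c z : ℂ) :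
    sphereTranslate c (z : OnePoint ℂ) = ((z + c : ℂ) : OnePoint ℂ) := rfl

theorem sphereTranslate_symm (c : ℂ) : (sphereTranslate c).symm = sphereTranslate (-c) := by
  refine Homeomorph.ext fun p => ?_
  rw [Homeomorph.symm_apply_eq]
  induction p using OnePoint.rec with
  | infty => rfl
  | coe z => rw [sphereTranslate_coe, sphereTranslate_coe, neg_add_cancel_right]

theorem sphereTranslate_sphereConj {c : ℂ} (hc : starRingEnd ℂ c = c) (p : OnePoint ℂ) :
    sphereTranslate c (sphereConj p) = sphereConj (sphereTranslate c p) := by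
  induction p using OnePoint.rec with
  | infty => rfl
  | coe z =>
    rw [sphereConj_coe, sphereTranslate_coe, sphereTranslate_coe, sphereConj_coe, map_add, hc]

theorem continuous_sphereChart (p : OnePoint ℂ) : Continuous (sphereChart p) := by
  induction p using OnePoint.rec with
  | infty =>
    rw [sphereChart_infty]
    exact continuous_sphereInv.comp OnePoint.continuous_coe
  | coe z =>
    rw [sphereChart_coe]
    exact OnePoint.continuous_coe

theorem sphereChart_injective (p : OnePoint ℂ) : Function.Injective (sphereChart p) := by
  induction p using OnePoint.rec with
  | infty =>
    rw [sphereChart_infty]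
    exact sphereInvHomeomorph.injective.comp OnePoint.coe_injective
  | coe z =>
    rw [sphereChart_coe]
    exact OnePoint.coe_injective

theorem sphereChart_sphereCoord (p : OnePoint ℂ) : sphereChart p (sphereCoord p) = p := by
  induction p using OnePoint.rec with
  | infty => rw [sphereChart_infty, sphereCoord_infty]; exact sphereInv_zero
  | coe z => rw [sphereChart_coe, sphereCoord_coe]

theorem tendsto_sphereChart (p : OnePoint ℂ) :
    Tendsto (sphereChart p) (𝓝 (sphereCoord p)) (𝓝 p) :=
  (continuous_sphereChart p).tendsto' _ _ (sphereChart_sphereCoord p)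

namespace SphereHolomorphicAt

variable {f h : OnePoint ℂ → OnePoint ℂ} {p : OnePoint ℂ}

theorem congr (hf : SphereHolomorphicAt f p) (hfh : f =ᶠ[𝓝 p] h) : SphereHolomorphicAt h p := by
  obtain ⟨g, hg, hgf⟩ := hf
  refine ⟨g, hg, ?_⟩
  filter_upwards [hgf, (tendsto_sphereChart p).eventually hfh] with w h1 h2
  rw [← h2, h1, hfh.eq_of_nhds]

theorem comp (hh : SphereHolomorphicAt h (f p)) (hf : SphereHolomorphicAt f p) :
    SphereHolomorphicAt (fun q => h (f q)) p := by
  obtain ⟨g, hg, hgf⟩ := hf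
  obtain ⟨k, hk, hkh⟩ := hh
  have hgp : g (sphereCoord p) = sphereCoord (f p) := by
    have := hgf.self_of_nhds
    rw [sphereChart_sphereCoord] at this
    refine sphereChart_injective (f p) ?_
    rw [← this, sphereChart_sphereCoord]
  rw [← hgp] at hk hkh
  refine ⟨fun w => k (g w), hk.comp hg, ?_⟩
  filter_upwards [hgf, hg.continuousAt.eventually hkh] with w h1 h2
  rw [h1, h2]

theorem of_analyticAt {g : ℂ → ℂ} {z : ℂ} (hg : AnalyticAt ℂ g z)
    (hfg : ∀ᶠ w : ℂ in 𝓝 z, f (w : OnePoint ℂ) = (g w : OnePoint ℂ)) :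
    SphereHolomorphicAt f (z : OnePoint ℂ) := by
  refine ⟨g, hg, ?_⟩
  rw [hfg.self_of_nhds, sphereChart_coe, sphereChart_coe]
  exact hfg

theorem analyticAt_sphereCoord {z : ℂ} (hf : SphereHolomorphicAt f (z : OnePoint ℂ))
    (hz : f (z : OnePoint ℂ) ≠ ∞) :
    AnalyticAt ℂ (fun w : ℂ => sphereCoord (f (w : OnePoint ℂ))) z := by
  obtain ⟨g, hg, hgf⟩ := hf
  obtain ⟨y, hy⟩ := OnePoint.ne_infty_iff_exists.1 hz
  rw [← hy, sphereChart_coe, sphereChart_coe] at hgf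
  refine AnalyticAt.congr hg ?_
  filter_upwards [hgf] with w hw
  rw [hw, sphereCoord_coe]

end SphereHolomorphicAt

theorem sphereHolomorphicAt_sphereInv (p : OnePoint ℂ) : SphereHolomorphicAt sphereInv p := by
  induction p using OnePoint.rec with
  | infty =>
    refine ⟨id, analyticAt_id, Eventually.of_forall fun w => ?_⟩
    rw [sphereInv_infty, sphereChart_infty, sphereChart_coe]
    exact sphereInv_sphereInv _
  | coe z =>
    rcases eq_or_ne z 0 with rfl | hz
    · refine ⟨id, analyticAt_id, Eventually.of_forall fun w => ?_⟩
      rw [sphereInv_zero, sphereChart_infty, sphereChart_coe]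
      rfl
    · refine SphereHolomorphicAt.of_analyticAt (analyticAt_inv hz) ?_
      filter_upwards [eventually_ne_nhds hz] with w hw
      exact sphereInv_coe hw

theorem sphereHolomorphicAt_sphereTranslate (c : ℂ) (p : OnePoint ℂ) :
    SphereHolomorphicAt (sphereTranslate c) p := by
  induction p using OnePoint.rec with
  | infty =>
    have hne : ∀ᶠ w : ℂ in 𝓝 0, 1 + c * w ≠ 0 := by
      have : ContinuousAt (fun w : ℂ => 1 + c * w) 0 := by fun_prop
      exact this.eventually_ne (by simp)
    refine ⟨fun w => w / (1 + c * w), ?_, ?_⟩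
    · rw [sphereCoord_infty]
      exact analyticAt_id.div (by fun_prop) (by simp)
    · rw [sphereTranslate_infty, sphereChart_infty, sphereCoord_infty]
      filter_upwards [hne] with w hw
      rcases eq_or_ne w 0 with rfl | hw0
      · rw [sphereInv_zero, sphereTranslate_infty, zero_div, sphereInv_zero]
      · rw [sphereInv_coe hw0, sphereTranslate_coe, sphereInv_coe (div_ne_zero hw0 hw)]
        congr 1
        field_simp
  | coe z =>
    exact SphereHolomorphicAt.of_analyticAt (g := fun w => w + c) (by fun_prop)
      (Eventually.of_forall fun w => sphereTranslate_coe c w)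

theorem sphereHolomorphicAt_coe {g : ℂ → ℂ} {z : ℂ} (hg : AnalyticAt ℂ g z) :
    SphereHolomorphicAt (fun p => ((g (sphereCoord p) : ℂ) : OnePoint ℂ)) (z : OnePoint ℂ) :=
  SphereHolomorphicAt.of_analyticAt hg (Eventually.of_forall fun _ => rfl)

theorem image_sphereConj_eq_iff {Ω : Set (OnePoint ℂ)} :
    sphereConj '' Ω = Ω ↔ ∀ p ∈ Ω, sphereConj p ∈ Ω := by
  refine ⟨fun h p hp => h ▸ Set.mem_image_of_mem _ hp, fun h => ?_⟩
  refine Set.Subset.antisymm (Set.image_subset_iff.2 h) fun p hp => ?_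
  exact ⟨sphereConj p, h p hp, sphereConj_sphereConj p⟩

/-- A conjugation-symmetric simply connected domain of the sphere containing `∞` admits a
conjugation-symmetric Riemann map from the unit disk sending `0` to `∞`. -/
theorem exists_symmetric_riemann_map {Ω : Set (OnePoint ℂ)} (hopen : IsOpen Ω)
    (hsc : IsSimplyConnected Ω) (hcompl : Set.Nontrivial Ωᶜ)
    (hsymm : ∀ p ∈ Ω, sphereConj p ∈ Ω) (hinf : ∞ ∈ Ω) :
    ∃ Φ : OnePoint ℂ → OnePoint ℂ,
      (∀ w : ℂ, ‖w‖ < 1 → SphereHolomorphicAt Φ w) ∧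
      Set.BijOn (fun w : ℂ => Φ w) (Metric.ball 0 1) Ω ∧
      Φ (0 : ℂ) = ∞ ∧
      (∀ w : ℂ, ‖w‖ < 1 → Φ (starRingEnd ℂ w : ℂ) = sphereConj (Φ w)) ∧
      (∃ f : ℂ → ℂ, DifferentiableOn ℂ f (Metric.ball 0 1) ∧
        ∀ w : ℂ, ‖w‖ < 1 → w ≠ 0 → Φ w = (f w / w : ℂ)) ∧
      ∀ C ⊆ Ω, IsCompact C → ∀ᶠ w : ℂ in innerCircleFilter, Φ w ∉ C := by
  set K : Set ℂ := {k | (k : OnePoint ℂ) ∉ Ω} with hKdef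
  have hfin : ∀ p ∉ Ω, ∃ k ∈ K, (k : OnePoint ℂ) = p := fun p hp => by
    obtain ⟨k, rfl⟩ := OnePoint.ne_infty_iff_exists.1 (ne_of_mem_of_not_mem hinf hp).symm
    exact ⟨k, hp, rfl⟩
  have hK : K.Nontrivial := by
    obtain ⟨p, hp, q, hq, hpq⟩ := hcompl
    obtain ⟨k, hk, rfl⟩ := hfin p hp
    obtain ⟨l, hl, rfl⟩ := hfin q hq
    exact ⟨k, hk, l, hl, fun h => hpq (by rw [h])⟩
  have hconj : ∀ k ∈ K, starRingEnd ℂ k ∈ K := fun k hk h => hk <| by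
    have := hsymm _ h
    rwa [sphereConj_coe, Complex.conj_conj] at this
  obtain ⟨a, ha⟩ := hK.nonempty
  set A : OnePoint ℂ ≃ₜ OnePoint ℂ := sphereInvHomeomorph.trans (sphereTranslate a) with hA
  have hA0 : A ((0 : ℂ) : OnePoint ℂ) = ∞ := by
    change sphereTranslate a (sphereInv ((0 : ℂ) : OnePoint ℂ)) = ∞
    rw [sphereInv_zero, sphereTranslate_infty]
  have hAinf : A ∞ = (a : OnePoint ℂ) := by
    change sphereTranslate a (sphereInv ∞) = _
    rw [sphereInv_infty, sphereTranslate_coe, zero_add]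
  have hAne : ∀ u : ℂ, u ≠ 0 → A (u : OnePoint ℂ) = (u⁻¹ + a : ℂ) := fun u hu => by
    change sphereTranslate a (sphereInv (u : OnePoint ℂ)) = _
    rw [sphereInv_coe hu, sphereTranslate_coe]
  have he : IsOpenEmbedding (fun u : ℂ => A (u : OnePoint ℂ)) :=
    A.isOpenEmbedding.comp OnePoint.isOpenEmbedding_coe
  set U : Set ℂ := (fun u : ℂ => A (u : OnePoint ℂ)) ⁻¹' Ω with hUdef
  have hrange : Ω ⊆ Set.range (fun u : ℂ => A (u : OnePoint ℂ)) := fun p hp => by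
    have : A.symm p ≠ ∞ := fun h => by
      rw [Homeomorph.symm_apply_eq, hAinf] at h
      exact ha (h ▸ hp)
    obtain ⟨u, hu⟩ := OnePoint.ne_infty_iff_exists.1 this
    exact ⟨u, by simp [hu]⟩
  have hU : ∀ u, u ∈ U ↔ ∀ k ∈ K, 1 + u * (a - k) ≠ 0 := by
    intro u
    rcases eq_or_ne u 0 with rfl | hu
    · simp [hUdef, hA0, hinf]
    · rw [hUdef, Set.mem_preimage, hAne u hu]
      constructor
      · rintro h k hk h0
        refine hk ?_
        rwa [show k = u⁻¹ + a by field_simp; linear_combination -h0]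
      · intro h
        by_contra hn
        refine h (u⁻¹ + a) hn ?_
        field_simp
        ring
  have hUc : IsSimplyConnected U := by
    rw [← he.isEmbedding.isSimplyConnected_image, hUdef, Set.image_preimage_eq_of_subset hrange]
    exact hsc
  obtain ⟨ψ, hψd, hψb, hψ0, hψ1, hψs, hψp⟩ := exists_symmetric_uniformization hK hconj ha hU
    (hopen.preimage he.continuous) hUc
  have hball : ∀ {w : ℂ}, ‖w‖ < 1 → w ∈ Metric.ball (0 : ℂ) 1 := fun h => by simpa using h
  have hψne : ∀ w : ℂ, ‖w‖ < 1 → w ≠ 0 → ψ w ≠ 0 := fun w hw hw0 h =>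
    hw0 (hψb.injOn (hball hw) (by simp) (h.trans hψ0.symm))
  refine ⟨fun p => A ((ψ (sphereCoord p) : ℂ) : OnePoint ℂ), fun w hw => ?_,
    ⟨fun w hw => hψb.mapsTo hw, fun w hw v hv h => hψb.injOn hw hv (he.injective h),
      fun p hp => ?_⟩, ?_, fun w hw => ?_, ⟨fun w => (dslope ψ 0 w)⁻¹ + a * w, ?_, ?_⟩, ?_⟩
  · have h1 := sphereHolomorphicAt_coe (hψd.analyticAt (Metric.isOpen_ball.mem_nhds (hball hw)))
    have h2 := (sphereHolomorphicAt_sphereInv _).comp h1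
    exact (sphereHolomorphicAt_sphereTranslate a _).comp h2
  · obtain ⟨u, rfl⟩ := hrange hp
    obtain ⟨w, hw, rfl⟩ := hψb.surjOn (show u ∈ U from hp)
    exact ⟨w, hw, rfl⟩
  · simp only [sphereCoord_coe, hψ0, hA0]
  · simp only [sphereCoord_coe]
    rcases eq_or_ne w 0 with rfl | hw0
    · rw [map_zero, hψ0, hA0, sphereConj_infty]
    · have hcw : ‖starRingEnd ℂ w‖ < 1 := by simpa using hw
      have h1 := hψne w hw hw0
      have h2 := hψne _ hcw (by simpa using hw0)
      have h3 := hψs _ hcw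
      rw [Complex.conj_conj] at h3
      have h4 : starRingEnd ℂ (ψ w) ≠ 0 := by simpa using h1
      rw [hAne _ h1, hAne _ h2, sphereConj_coe, map_add, map_inv₀]
      congr 1
      field_simp
      linear_combination -h3
  · refine DifferentiableOn.add (DifferentiableOn.fun_inv ?_ fun w hw => ?_) (by fun_prop)
    · exact (Complex.differentiableOn_dslope (Metric.ball_mem_nhds 0 one_pos)).2 hψd
    · rcases eq_or_ne w 0 with rfl | hw0
      · rwa [dslope_same]
      · rw [dslope_of_ne _ hw0, slope_def_field, hψ0, sub_zero, sub_zero]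
        exact div_ne_zero (hψne w (by simpa using hw) hw0) hw0
  · intro w hw hw0
    have h1 := hψne w hw hw0
    simp only [sphereCoord_coe]
    rw [hAne _ h1, dslope_of_ne _ hw0, slope_def_field, hψ0, sub_zero, sub_zero]
    congr 1
    field_simp
  · intro C hC hCc
    exact hψp _ (Set.preimage_mono hC)
      ((he.isInducing.isCompact_preimage_iff (hC.trans hrange)).2 hCc)

theorem continuousAt_sphereCoord (z : ℂ) : ContinuousAt sphereCoord (z : OnePoint ℂ) := by
  rw [OnePoint.continuousAt_coe]
  exact continuousAt_id

theorem coe_sphereCoord {p : OnePoint ℂ} (hp : p ≠ ∞) : (sphereCoord p : OnePoint ℂ) = p := by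
  obtain ⟨z, rfl⟩ := OnePoint.ne_infty_iff_exists.1 hp
  rfl

theorem coe_mem_sphereUnitDisk {w : ℂ} : (w : OnePoint ℂ) ∈ sphereUnitDisk ↔ ‖w‖ < 1 := by
  rw [sphereUnitDisk, OnePoint.coe_injective.mem_set_image, mem_ball_zero_iff]

theorem infty_notMem_sphereUnitDisk : ∞ ∉ sphereUnitDisk := by
  rintro ⟨z, -, hz⟩
  exact OnePoint.coe_ne_infty z hz

theorem isOpen_sphereUnitDisk : IsOpen sphereUnitDisk :=
  OnePoint.isOpenEmbedding_coe.isOpenMap _ Metric.isOpen_ball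

theorem sphereConj_mem_sphereUnitDisk {p : OnePoint ℂ} :
    sphereConj p ∈ sphereUnitDisk ↔ p ∈ sphereUnitDisk := by
  induction p using OnePoint.rec with
  | infty => rfl
  | coe z =>
    rw [sphereConj_coe, coe_mem_sphereUnitDisk, coe_mem_sphereUnitDisk, RCLike.norm_conj]

theorem sphereInv_coe_mem_sphereUnitDisk {w : ℂ} :
    sphereInv (w : OnePoint ℂ) ∈ sphereUnitDisk ↔ 1 < ‖w‖ := by
  rcases eq_or_ne w 0 with rfl | hw
  · rw [sphereInv_zero, norm_zero]
    exact iff_of_false infty_notMem_sphereUnitDisk (by norm_num)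
  · rw [sphereInv_coe hw, coe_mem_sphereUnitDisk, norm_inv, inv_lt_one₀ (norm_pos_iff.2 hw)]

theorem sphereInv_notMem_sphereUnitDisk {p : OnePoint ℂ} (hp : p ∈ sphereUnitDisk) :
    sphereInv p ∉ sphereUnitDisk := by
  obtain ⟨w, hw, rfl⟩ := hp
  rw [sphereInv_coe_mem_sphereUnitDisk]
  exact (mem_ball_zero_iff.1 hw).le.not_gt

theorem tendsto_conj_innerCircleFilter :
    Tendsto (starRingEnd ℂ) innerCircleFilter innerCircleFilter := by
  rw [innerCircleFilter, tendsto_comap_iff]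
  refine tendsto_comap.congr fun w => ?_
  simp

/-- A map of the disk into a domain `Ω` of the sphere that leaves every compact subset of `Ω`
asymptotically satisfies the boundary relation `F = ι` of a continuous map `F` on the closure. -/
theorem eventually_ne_infty_and_tendsto_sphereCoord_sub {Ω : Set (OnePoint ℂ)} (hopen : IsOpen Ω)
    (hinf : ∞ ∈ Ω) {F Φ : OnePoint ℂ → OnePoint ℂ} (hF_cont : ContinuousOn F (closure Ω))
    (hF_bdry : ∀ z ∈ frontier Ω, F z = sphereConj z) (hΦ : ∀ w : ℂ, ‖w‖ < 1 → Φ w ∈ Ω)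
    (hproper : ∀ C ⊆ Ω, IsCompact C → ∀ᶠ w : ℂ in innerCircleFilter, Φ w ∉ C) :
    (∀ᶠ w : ℂ in innerCircleFilter, F (Φ w) ≠ ∞) ∧
      Tendsto (fun w : ℂ => sphereCoord (F (Φ w)) - starRingEnd ℂ (sphereCoord (Φ w)))
        innerCircleFilter (𝓝 0) := by
  have key : ∀ u : Ultrafilter ℂ, (u : Filter ℂ) ≤ innerCircleFilter →
      ∃ b : ℂ, Tendsto (fun w : ℂ => Φ w) u (𝓝 (b : OnePoint ℂ)) ∧
        Tendsto (fun w : ℂ => F (Φ w)) u (𝓝 ((starRingEnd ℂ b : ℂ) : OnePoint ℂ)) := by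
    intro u hu
    obtain ⟨b, -, hb⟩ := isCompact_univ.ultrafilter_le_nhds (u.map fun w : ℂ => Φ w) (by simp)
    replace hb : Tendsto (fun w : ℂ => Φ w) u (𝓝 b) := hb
    have hbΩ : b ∉ Ω := fun hbΩ => by
      obtain ⟨C, hC, hCΩ, hCc⟩ := local_compact_nhds (hopen.mem_nhds hbΩ)
      obtain ⟨w, hw, hw'⟩ := ((hb.eventually hC).and (hu (hproper C hCΩ hCc))).exists
      exact hw' hw
    have hmem : ∀ᶠ w : ℂ in (u : Filter ℂ), Φ w ∈ Ω := by
      filter_upwards [hu (eventually_norm_innerCircleFilter zero_lt_one)] with w hw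
      exact hΦ w hw.2
    have hbc : b ∈ closure Ω := mem_closure_of_tendsto hb hmem
    have hbf : b ∈ frontier Ω := ⟨hbc, by rwa [hopen.interior_eq]⟩
    have hFb : Tendsto (fun w : ℂ => F (Φ w)) u (𝓝 (F b)) :=
      (hF_cont b hbc).tendsto.comp
        (tendsto_nhdsWithin_iff.2 ⟨hb, hmem.mono fun _ h => subset_closure h⟩)
    rw [hF_bdry b hbf] at hFb
    obtain ⟨z, rfl⟩ := OnePoint.ne_infty_iff_exists.1 (ne_of_mem_of_not_mem hinf hbΩ).symm
    exact ⟨z, hb, hFb⟩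
  constructor
  · rw [Filter.Eventually, Filter.mem_iff_ultrafilter]
    intro u hu
    obtain ⟨b, -, hb⟩ := key u hu
    exact hb.eventually_ne (OnePoint.coe_ne_infty _)
  · rw [tendsto_iff_ultrafilter]
    intro u hu
    obtain ⟨b, hb, hFb⟩ := key u hu
    have h1 := (continuousAt_sphereCoord _).tendsto.comp hFb
    have h2 := (Complex.continuous_conj.tendsto _).comp
      ((continuousAt_sphereCoord _).tendsto.comp hb)
    have h3 := h1.sub h2
    rwa [sphereCoord_coe, sphereCoord_coe, sub_self] at h3

theorem real_symmetric_mating_of_infty_mem {Ω : Set (OnePoint ℂ)} (hopen : IsOpen Ω)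
    (hsc : IsSimplyConnected Ω) (hcompl : Set.Nontrivial Ωᶜ)
    (hsymm : ∀ p ∈ Ω, sphereConj p ∈ Ω) (hinf : ∞ ∈ Ω) {F : OnePoint ℂ → OnePoint ℂ}
    (hF_cont : ContinuousOn F (closure Ω)) (hF_mero : ∀ p ∈ Ω, SphereHolomorphicAt F p)
    (hF_symm : ∀ z ∈ Ω, F (sphereConj z) = sphereConj (F z))
    (hF_bdry : ∀ z ∈ frontier Ω, F z = sphereConj z) :
    ∃ R : OnePoint ℂ → OnePoint ℂ,
      (∀ p, SphereHolomorphicAt R p) ∧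
      (∀ z, sphereConj (R z) = R (sphereConj z)) ∧
      Set.InjOn R sphereUnitDisk ∧
      R '' sphereUnitDisk = Ω ∧
      ∀ w ∈ sphereUnitDisk, F (R w) = R (sphereInv w) := by
  obtain ⟨Φ, hΦd, hΦb, -, hΦs, ⟨f, hfd, hfΦ⟩, hΦp⟩ :=
    exists_symmetric_riemann_map hopen hsc hcompl hsymm hinf
  have hΦm : ∀ w : ℂ, ‖w‖ < 1 → Φ w ∈ Ω := fun w hw => hΦb.mapsTo (mem_ball_zero_iff.2 hw)
  obtain ⟨hne, hlim⟩ := eventually_ne_infty_and_tendsto_sphereCoord_sub hopen hinf hF_cont hF_bdry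
    hΦm hΦp
  obtain ⟨M, hM⟩ : ∃ M : ℝ, ∀ᶠ w : ℂ in innerCircleFilter, ‖f w / w‖ ≤ M := by
    have hK : IsCompact (((↑) : ℂ → OnePoint ℂ) ⁻¹' Ω)ᶜ :=
      ((OnePoint.isOpen_iff_of_mem hinf).1 hopen).2
    obtain ⟨M, hM⟩ := hK.isBounded.subset_ball 0
    refine ⟨M, ?_⟩
    have hCΩ : (((↑) : ℂ → OnePoint ℂ) '' Metric.ball 0 M)ᶜ ⊆ Ω := by
      rw [Set.compl_subset_comm]
      intro p hp
      obtain ⟨k, rfl⟩ := OnePoint.ne_infty_iff_exists.1 (ne_of_mem_of_not_mem hinf hp).symm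
      exact ⟨k, hM hp, rfl⟩
    have hCc : IsCompact (((↑) : ℂ → OnePoint ℂ) '' Metric.ball 0 M)ᶜ :=
      (OnePoint.isOpenEmbedding_coe.isOpenMap _ Metric.isOpen_ball).isClosed_compl.isCompact
    filter_upwards [hΦp _ hCΩ hCc, eventually_norm_innerCircleFilter zero_lt_one] with w h1 h2
    rw [hfΦ w h2.2 (norm_pos_iff.1 h2.1), Set.notMem_compl_iff,
      OnePoint.coe_injective.mem_set_image, mem_ball_zero_iff] at h1
    exact h1.le
  obtain ⟨r, hr0, hr1, hr⟩ : ∃ r : ℝ, 0 < r ∧ r < 1 ∧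
      ∀ w : ℂ, r < ‖w‖ → ‖w‖ < 1 → F (Φ w) ≠ ∞ := by
    rw [innerCircleFilter, eventually_comap] at hne
    obtain ⟨r, hr, hr'⟩ := (mem_nhdsLT_iff_exists_Ioo_subset' (zero_lt_one (α := ℝ))).1 hne
    exact ⟨max r (1 / 2), by positivity, max_lt hr (by norm_num),
      fun w h1 h2 => hr' ⟨(le_max_left _ _).trans_lt h1, h2⟩ w rfl⟩
  have hFΦ : ∀ w : ℂ, ‖w‖ < 1 → SphereHolomorphicAt (fun p => F (Φ p)) w := fun w hw =>
    (hF_mero _ (hΦm w hw)).comp (hΦd w hw)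
  set q : ℂ → ℂ := fun v => sphereCoord (F (Φ v)) with hq
  have hinv : ∀ z : ℂ, 1 < ‖z‖ → ‖z‖ < r⁻¹ → r < ‖z⁻¹‖ ∧ ‖z⁻¹‖ < 1 := fun z h1 h2 => by
    rw [norm_inv]
    exact ⟨(lt_inv_comm₀ (by linarith) hr0).1 h2, inv_lt_one_of_one_lt₀ h1⟩
  have hg : ∀ z : ℂ, 1 < ‖z‖ → ‖z‖ < r⁻¹ → DifferentiableAt ℂ (fun z => z * q z⁻¹) z := by
    intro z h1 h2
    have hz : z ≠ 0 := norm_pos_iff.1 (by linarith)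
    obtain ⟨h3, h4⟩ := hinv z h1 h2
    have h5 : DifferentiableAt ℂ q z⁻¹ :=
      ((hFΦ _ h4).analyticAt_sphereCoord (hr _ h3 h4)).differentiableAt
    exact differentiableAt_id.mul (h5.comp z (differentiableAt_inv hz))
  have hfg : Tendsto (fun z => (starRingEnd ℂ z)⁻¹ * q (starRingEnd ℂ z)⁻¹⁻¹ - f z)
      innerCircleFilter (𝓝 0) := by
    have h1 : Tendsto (fun w : ℂ => q (starRingEnd ℂ w) - f w / w) innerCircleFilter (𝓝 0) := by
      refine (hlim.comp tendsto_conj_innerCircleFilter).congr' ?_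
      filter_upwards [eventually_norm_innerCircleFilter zero_lt_one] with w hw
      simp only [Function.comp_apply, hq]
      rw [hΦs w hw.2, hfΦ w hw.2 (norm_pos_iff.1 hw.1), sphereConj_coe, sphereCoord_coe,
        Complex.conj_conj]
    have h2 := tendsto_conj_inv_sub_self
    have hb : IsBoundedUnder (· ≤ ·) innerCircleFilter (norm ∘ fun w : ℂ => w) :=
      ⟨1, eventually_map.2 ((eventually_norm_innerCircleFilter zero_lt_one).mono fun _ hw => hw.2.le)⟩
    have h3 := ((h1.zero_mul_isBoundedUnder_le hb).add (h2.mul h1)).add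
      (h2.zero_mul_isBoundedUnder_le (g := fun w => f w / w) ⟨M, hM⟩)
    rw [mul_zero, add_zero, add_zero] at h3
    refine h3.congr' ?_
    filter_upwards [eventually_norm_innerCircleFilter zero_lt_one] with w hw
    have hw0 : w ≠ 0 := norm_pos_iff.1 hw.1
    rw [inv_inv]
    field_simp
    ring
  have hb : ∃ M, ∀ᶠ z : ℂ in innerCircleFilter, ‖f z‖ ≤ M := by
    refine ⟨M, ?_⟩
    filter_upwards [hM, eventually_norm_innerCircleFilter zero_lt_one] with w h1 h2
    have hw0 : w ≠ 0 := norm_pos_iff.1 h2.1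
    calc ‖f w‖ = ‖f w / w‖ * ‖w‖ := by rw [← norm_mul, div_mul_cancel₀ _ hw0]
      _ ≤ ‖f w / w‖ := mul_le_of_le_one_right (norm_nonneg _) h2.2.le
      _ ≤ M := h1
  obtain ⟨h, s, hs1, hsr, hh, hhf, hhg⟩ := exists_analytic_extension_across_unit_circle
    ((one_lt_inv₀ hr0).2 hr1) hfd hg hfg hb
  set R : OnePoint ℂ → OnePoint ℂ := fun p =>
    if p ∈ sphereUnitDisk then Φ p
    else if sphereInv p ∈ sphereUnitDisk then F (Φ (sphereInv p))
    else ((h (sphereCoord p) / sphereCoord p : ℂ) : OnePoint ℂ) with hR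
  have hR_in : ∀ p ∈ sphereUnitDisk, R p = Φ p := fun p hp => if_pos hp
  have hR_out : ∀ p, sphereInv p ∈ sphereUnitDisk → R p = F (Φ (sphereInv p)) := fun p hp => by
    have : p ∉ sphereUnitDisk := fun h' => sphereInv_notMem_sphereUnitDisk h' hp
    rw [hR]
    simp only [this, hp, if_true, if_false]
  have hR_ann : ∀ w : ℂ, w ≠ 0 → ‖w‖ < s → R w = (h w / w : ℂ) := fun w hw0 hw => by
    rcases lt_trichotomy ‖w‖ 1 with h1 | h1 | h1
    · rw [hR_in _ (coe_mem_sphereUnitDisk.2 h1), hfΦ w h1 hw0, hhf w h1]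
    · have h2 : (w : OnePoint ℂ) ∉ sphereUnitDisk := by rw [coe_mem_sphereUnitDisk, h1]; simp
      have h3 : sphereInv (w : OnePoint ℂ) ∉ sphereUnitDisk := by
        rw [sphereInv_coe_mem_sphereUnitDisk, h1]; simp
      rw [hR]
      simp only [h2, h3, if_false, sphereCoord_coe]
    · obtain ⟨h3, h4⟩ := hinv w h1 (hw.trans hsr)
      rw [hR_out _ (sphereInv_coe_mem_sphereUnitDisk.2 h1), hhg w h1 hw, mul_div_cancel_left₀ _ hw0,
        sphereInv_coe hw0, hq]
      exact (coe_sphereCoord (hr _ h3 h4)).symm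
  have hcases : ∀ p, p ∈ sphereUnitDisk ∨ sphereInv p ∈ sphereUnitDisk ∨
      ∃ w : ℂ, ‖w‖ = 1 ∧ p = w := fun p => by
    induction p using OnePoint.rec with
    | infty =>
      rw [sphereInv_infty, coe_mem_sphereUnitDisk]
      simp
    | coe w =>
      rw [coe_mem_sphereUnitDisk, sphereInv_coe_mem_sphereUnitDisk]
      rcases lt_trichotomy ‖w‖ 1 with h1 | h1 | h1
      exacts [.inl h1, .inr (.inr ⟨w, h1, rfl⟩), .inr (.inl h1)]
  have hh_conj : ∀ z : ℂ, ‖z‖ = 1 → h (starRingEnd ℂ z) = starRingEnd ℂ (h z) := fun z hz => by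
    have hz0 : z ≠ 0 := norm_pos_iff.1 (by rw [hz]; exact one_pos)
    have hzc : z ∈ closure (Metric.ball (0 : ℂ) 1) := by
      rw [closure_ball _ one_ne_zero]
      simp [hz]
    have : (𝓝[Metric.ball (0 : ℂ) 1] z).NeBot := mem_closure_iff_nhdsWithin_neBot.1 hzc
    have h1 : ContinuousAt (fun w => h (starRingEnd ℂ w)) z :=
      (hh (starRingEnd ℂ z) (by simpa [hz] using hs1)).continuousAt.comp
        Complex.continuous_conj.continuousAt
    have h2 : ContinuousAt (fun w => starRingEnd ℂ (h w)) z :=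
      Complex.continuous_conj.continuousAt.comp (hh z (hz ▸ hs1)).continuousAt
    refine tendsto_nhds_unique_of_eventuallyEq (l := 𝓝[Metric.ball (0 : ℂ) 1] z)
      (h1.mono_left nhdsWithin_le_nhds)
      (h2.mono_left nhdsWithin_le_nhds) ?_
    filter_upwards [self_mem_nhdsWithin, nhdsWithin_le_nhds (eventually_ne_nhds hz0)] with w hw hw0
    have hw1 : ‖w‖ < 1 := mem_ball_zero_iff.1 hw
    have hcw : ‖starRingEnd ℂ w‖ < 1 := by rwa [RCLike.norm_conj]
    have hcw0 : starRingEnd ℂ w ≠ 0 := by simpa using hw0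
    have h3 := hΦs w hw1
    rw [hfΦ _ hcw hcw0, hfΦ w hw1 hw0, sphereConj_coe, map_div₀] at h3
    rw [hhf w hw1, hhf _ hcw]
    exact (div_left_inj' hcw0).1 (OnePoint.coe_injective h3)
  refine ⟨R, fun p => ?_, fun p => ?_, ?_, ?_, ?_⟩
  · rcases hcases p with hp | hp | ⟨z, hz, rfl⟩
    · have hp' := hp
      obtain ⟨w, hw, rfl⟩ := hp
      refine (hΦd w (mem_ball_zero_iff.1 hw)).congr ?_
      filter_upwards [isOpen_sphereUnitDisk.mem_nhds hp'] with p' h'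
      exact (hR_in p' h').symm
    · have hp' := hp
      obtain ⟨w, hw, hwp⟩ := hp
      have h1 := hFΦ w (mem_ball_zero_iff.1 hw)
      replace hwp : (w : OnePoint ℂ) = sphereInv p := hwp
      rw [hwp] at h1
      refine (h1.comp (sphereHolomorphicAt_sphereInv p)).congr ?_
      filter_upwards [(isOpen_sphereUnitDisk.preimage continuous_sphereInv).mem_nhds hp'] with p' h'
      exact (hR_out p' h').symm
    · have hz0 : z ≠ 0 := norm_pos_iff.1 (by rw [hz]; exact one_pos)
      refine SphereHolomorphicAt.of_analyticAt ((hh z (hz ▸ hs1)).div analyticAt_id hz0) ?_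
      filter_upwards [eventually_ne_nhds hz0,
        continuous_norm.continuousAt.eventually_lt_const (hz ▸ hs1)] with w h1 h2
      exact hR_ann w h1 h2
  · rcases hcases p with hp | hp | ⟨z, hz, rfl⟩
    · rw [hR_in p hp, hR_in _ (sphereConj_mem_sphereUnitDisk.2 hp)]
      obtain ⟨w, hw, rfl⟩ := hp
      exact (hΦs w (mem_ball_zero_iff.1 hw)).symm
    · have h1 : sphereInv (sphereConj p) ∈ sphereUnitDisk := by
        rwa [sphereInv_sphereConj, sphereConj_mem_sphereUnitDisk]
      rw [hR_out p hp, hR_out _ h1, sphereInv_sphereConj]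
      obtain ⟨w, hw, hwp⟩ := hp
      have hw1 := mem_ball_zero_iff.1 hw
      rw [← hwp, sphereConj_coe, hΦs w hw1, hF_symm _ (hΦm w hw1)]
    · have hz0 : z ≠ 0 := norm_pos_iff.1 (by rw [hz]; exact one_pos)
      have hcz : ‖starRingEnd ℂ z‖ = 1 := by rwa [RCLike.norm_conj]
      rw [sphereConj_coe, hR_ann z hz0 (hz ▸ hs1),
        hR_ann _ (by simpa using hz0) (hcz.symm ▸ hs1), hh_conj z hz, sphereConj_coe, map_div₀]
  · rintro _ ⟨w, hw, rfl⟩ _ ⟨v, hv, rfl⟩ hwv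
    dsimp only at hwv
    rw [hR_in _ ⟨w, hw, rfl⟩, hR_in _ ⟨v, hv, rfl⟩] at hwv
    rw [hΦb.injOn hw hv hwv]
  · rw [Set.image_congr hR_in, sphereUnitDisk, Set.image_image]
    exact hΦb.image_eq
  · intro w hw
    have h1 : sphereInv (sphereInv w) ∈ sphereUnitDisk := by rwa [sphereInv_sphereInv]
    rw [hR_in w hw, hR_out _ h1, sphereInv_sphereInv]

/-- A conjugation-symmetric connected subset of the sphere meets the extended real line. -/
theorem infty_mem_or_exists_ofReal_mem {Ω : Set (OnePoint ℂ)} (hconn : IsConnected Ω)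
    (hsymm : ∀ p ∈ Ω, sphereConj p ∈ Ω) : ∞ ∈ Ω ∨ ∃ x : ℝ, ((x : ℂ) : OnePoint ℂ) ∈ Ω := by
  by_contra! h
  obtain ⟨h1, h2⟩ := h
  have him : ∀ z : ℂ, (z : OnePoint ℂ) ∈ Ω → z.im ≠ 0 := fun z hz h0 =>
    h2 z.re (by rwa [← show z = z.re from Complex.ext rfl h0])
  have hopen : ∀ S : Set ℂ, IsOpen S → IsOpen (((↑) : ℂ → OnePoint ℂ) '' S) :=
    OnePoint.isOpenEmbedding_coe.isOpenMap
  obtain ⟨p, hp⟩ := hconn.nonempty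
  obtain ⟨z, rfl⟩ := OnePoint.ne_infty_iff_exists.1 (ne_of_mem_of_not_mem hp h1)
  have hz' := hsymm _ hp
  rw [sphereConj_coe] at hz'
  obtain ⟨q, -, ⟨u, hu, rfl⟩, ⟨v, hv, huv⟩⟩ := hconn.isPreconnected
    (((↑) : ℂ → OnePoint ℂ) '' {z | 0 < z.im}) (((↑) : ℂ → OnePoint ℂ) '' {z | z.im < 0})
    (hopen _ (isOpen_lt continuous_const Complex.continuous_im))
    (hopen _ (isOpen_lt Complex.continuous_im continuous_const))
    (fun p hp => by
      obtain ⟨w, rfl⟩ := OnePoint.ne_infty_iff_exists.1 (ne_of_mem_of_not_mem hp h1)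
      exact (him w hp).lt_or_gt.symm.imp (fun h => ⟨w, h, rfl⟩) (fun h => ⟨w, h, rfl⟩))
    (by
      rcases (him z hp).lt_or_gt with h | h
      exacts [⟨_, hz', _, by simpa using h, rfl⟩, ⟨_, hp, _, h, rfl⟩])
    (by
      rcases (him z hp).lt_or_gt with h | h
      exacts [⟨_, hp, _, h, rfl⟩, ⟨_, hz', _, by simpa using h, rfl⟩])
  rw [OnePoint.coe_injective huv] at hv
  exact lt_asymm (show 0 < u.im from hu) (show u.im < 0 from hv)

theorem real_symmetric_mating_of_ofReal_mem {Ω : Set (OnePoint ℂ)} (hopen : IsOpen Ω)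
    (hsc : IsSimplyConnected Ω) (hcompl : Set.Nontrivial Ωᶜ)
    (hsymm : ∀ p ∈ Ω, sphereConj p ∈ Ω) {x : ℝ} (hx : ((x : ℂ) : OnePoint ℂ) ∈ Ω)
    {F : OnePoint ℂ → OnePoint ℂ}
    (hF_cont : ContinuousOn F (closure Ω)) (hF_mero : ∀ p ∈ Ω, SphereHolomorphicAt F p)
    (hF_symm : ∀ z ∈ Ω, F (sphereConj z) = sphereConj (F z))
    (hF_bdry : ∀ z ∈ frontier Ω, F z = sphereConj z) :
    ∃ R : OnePoint ℂ → OnePoint ℂ,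
      (∀ p, SphereHolomorphicAt R p) ∧
      (∀ z, sphereConj (R z) = R (sphereConj z)) ∧
      Set.InjOn R sphereUnitDisk ∧
      R '' sphereUnitDisk = Ω ∧
      ∀ w ∈ sphereUnitDisk, F (R w) = R (sphereInv w) := by
  set T : OnePoint ℂ ≃ₜ OnePoint ℂ := (sphereTranslate (-x)).trans sphereInvHomeomorph with hT
  have hT_apply : ∀ p, T p = sphereInv (sphereTranslate (-x) p) := fun p => rfl
  have hT_symm_apply : ∀ p, T.symm p = sphereTranslate x (sphereInv p) := fun p => by
    rw [Homeomorph.symm_apply_eq, hT_apply, ← sphereTranslate_symm, Homeomorph.symm_apply_apply,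
      sphereInv_sphereInv]
  have hT_conj : ∀ p, T (sphereConj p) = sphereConj (T p) := fun p => by
    rw [hT_apply, hT_apply, sphereTranslate_sphereConj (by simp), sphereInv_sphereConj]
  have hT_symm_conj : ∀ p, T.symm (sphereConj p) = sphereConj (T.symm p) := fun p => by
    rw [Homeomorph.symm_apply_eq, hT_conj, Homeomorph.apply_symm_apply]
  have hT_hol : ∀ p, SphereHolomorphicAt T p := fun p =>
    (sphereHolomorphicAt_sphereInv _).comp (sphereHolomorphicAt_sphereTranslate _ p)
  have hT_symm_hol : ∀ p, SphereHolomorphicAt T.symm p := fun p => by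
    rw [show (T.symm : OnePoint ℂ → OnePoint ℂ) = _ from funext hT_symm_apply]
    exact (sphereHolomorphicAt_sphereTranslate _ _).comp (sphereHolomorphicAt_sphereInv p)
  have hTx : T ((x : ℂ) : OnePoint ℂ) = ∞ := by
    rw [hT_apply, sphereTranslate_coe, add_neg_cancel, sphereInv_zero]
  have hmem : ∀ p ∈ T '' Ω, T.symm p ∈ Ω := by
    rintro _ ⟨p, hp, rfl⟩
    rwa [Homeomorph.symm_apply_apply]
  obtain ⟨R, hRd, hRs, hRi, hRo, hRF⟩ := real_symmetric_mating_of_infty_mem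
    (Ω := T '' Ω) (F := fun p => T (F (T.symm p))) (T.isOpenMap _ hopen)
    (T.isEmbedding.isSimplyConnected_image.2 hsc)
    (by rw [← Set.image_compl_eq T.bijective]; exact hcompl.image T.injective)
    (by rintro _ ⟨p, hp, rfl⟩; exact ⟨_, hsymm p hp, hT_conj p⟩)
    ⟨_, hx, hTx⟩
    (by
      rw [← T.image_closure]
      refine T.continuous.comp_continuousOn (hF_cont.comp T.symm.continuous.continuousOn ?_)
      rintro _ ⟨p, hp, rfl⟩
      rwa [Homeomorph.symm_apply_apply])
    (fun p hp => (hT_hol _).comp ((hF_mero _ (hmem p hp)).comp (hT_symm_hol p)))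
    (fun p hp => by rw [hT_symm_conj, hF_symm _ (hmem p hp), hT_conj])
    (by
      rw [← T.image_frontier]
      rintro _ ⟨p, hp, rfl⟩
      rw [Homeomorph.symm_apply_apply, hF_bdry p hp, hT_conj])
  refine ⟨fun p => T.symm (R p), fun p => (hT_symm_hol _).comp (hRd p), fun p => ?_,
    T.symm.injective.comp_injOn hRi, ?_, fun w hw => ?_⟩
  · rw [← hT_symm_conj, hRs]
  · rw [← Set.image_image T.symm, hRo, Set.image_image]
    simp
  · dsimp only
    rw [← hRF w hw, Homeomorph.symm_apply_apply]

/-- The real-symmetric, single-domain case of Lemma 4.4 of the paper: if `Ω ⊊ ℂ̂` is a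
simply connected domain with locally connected boundary, complement containing at least
two points, and `ι(Ω) = Ω`, and `F : Ω̄ → ℂ̂` is continuous, meromorphic on `Ω`,
commutes with `ι` on `Ω̄`, and equals `ι` on `∂Ω`, then there is a real-symmetric
rational map `R` (i.e. `ι ∘ R = R ∘ ι`) carrying `𝔻` univalently onto `Ω` with
`F = R ∘ η ∘ (R|_𝔻)⁻¹` on `Ω`. -/
theorem real_symmetric_mating_rational_uniformization
    (Ω : Set (OnePoint ℂ)) (hopen : IsOpen Ω) (hconn : IsConnected Ω)
    (hsc : SimplyConnectedSpace Ω)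
    (hcompl : Set.Nontrivial Ωᶜ)
    (hlc : LocallyConnectedSpace (frontier Ω))
    (hsymm : sphereConj '' Ω = Ω)
    (F : OnePoint ℂ → OnePoint ℂ)
    (hF_cont : ContinuousOn F (closure Ω))
    (hF_mero : ∀ p ∈ Ω, SphereHolomorphicAt F p)
    (hF_symm : ∀ z ∈ closure Ω, F (sphereConj z) = sphereConj (F z))
    (hF_bdry : ∀ z ∈ frontier Ω, F z = sphereConj z) :
    ∃ R : OnePoint ℂ → OnePoint ℂ,
      IsRationalMap R ∧
      (∀ z, sphereConj (R z) = R (sphereConj z)) ∧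
      Set.InjOn R sphereUnitDisk ∧
      R '' sphereUnitDisk = Ω ∧
      ∀ z ∈ Ω, ∀ w ∈ sphereUnitDisk, R w = z → F z = R (sphereInv w) := by
  have hsymm' := image_sphereConj_eq_iff.1 hsymm
  have hF_symm' : ∀ z ∈ Ω, F (sphereConj z) = sphereConj (F z) := fun z hz =>
    hF_symm z (subset_closure hz)
  obtain ⟨R, hRd, hRs, hRi, hRo, hRF⟩ : ∃ R : OnePoint ℂ → OnePoint ℂ,
      (∀ p, SphereHolomorphicAt R p) ∧
      (∀ z, sphereConj (R z) = R (sphereConj z)) ∧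
      Set.InjOn R sphereUnitDisk ∧
      R '' sphereUnitDisk = Ω ∧
      ∀ w ∈ sphereUnitDisk, F (R w) = R (sphereInv w) := by
    rcases infty_mem_or_exists_ofReal_mem hconn hsymm' with hinf | ⟨x, hx⟩
    · exact real_symmetric_mating_of_infty_mem hopen hsc hcompl hsymm' hinf hF_cont hF_mero
        hF_symm' hF_bdry
    · exact real_symmetric_mating_of_ofReal_mem hopen hsc hcompl hsymm' hx hF_cont hF_mero
        hF_symm' hF_bdry
  refine ⟨R, ⟨hRd, fun c hc => ?_⟩, hRs, hRi, hRo, ?_⟩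
  · have h0 : ((0 : ℂ) : OnePoint ℂ) ∈ sphereUnitDisk := by simp [coe_mem_sphereUnitDisk]
    have h1 : ((1 / 2 : ℂ) : OnePoint ℂ) ∈ sphereUnitDisk := by
      rw [coe_mem_sphereUnitDisk]
      norm_num
    have h2 := OnePoint.coe_injective (hRi h0 h1 (by rw [hc]))
    norm_num at h2
  · rintro _ - w hw rfl
    exact hRF w hw
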